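/- arXiv:1110.6832 — 2 statements merged into one kernel-verified Lean document; each statement's English description precedes it below -/
import Mathlib

section
/- There is a universal constant C such that: in every directed polymatroidal network on n ≥ 3 nodes, for any multicommodity flow instance with symmetric demands on k ≥ 2 unordered pairs s_1t_1,…,s_kt_k, if β is the value of the maximum throughput multicommodity flow for the symmetric demands, then there exists a feasible multicut F (separating, for each i, the pair (s_i,t_i) or the pair (t_i,s_i)) with ν(F) ≤ C·min{(log k)², (log n)·(log log n)}·β. -/
open Finset MeasureTheory
open scoped ENNReal Classical

/-- A directed polymatroidal network: a finite directed graph together with,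
for each node `v`, polymatroids `rhoM v` on the edges entering `v` and
`rhoP v` on the edges leaving `v`. -/
structure DirPolyNet (V E : Type) [Fintype V] [Fintype E] [DecidableEq V] [DecidableEq E] where
  tail : E → V
  head : E → V
  rhoM : V → Finset E → ℝ
  rhoP : V → Finset E → ℝ
  rhoM_empty : ∀ v, rhoM v ∅ = 0
  rhoP_empty : ∀ v, rhoP v ∅ = 0
  rhoM_nonneg : ∀ v A, A ⊆ Finset.univ.filter (fun e => head e = v) → 0 ≤ rhoM v A
  rhoP_nonneg : ∀ v A, A ⊆ Finset.univ.filter (fun e => tail e = v) → 0 ≤ rhoP v A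
  rhoM_mono : ∀ v A B, A ⊆ B → B ⊆ Finset.univ.filter (fun e => head e = v) →
    rhoM v A ≤ rhoM v B
  rhoP_mono : ∀ v A B, A ⊆ B → B ⊆ Finset.univ.filter (fun e => tail e = v) →
    rhoP v A ≤ rhoP v B
  rhoM_submod : ∀ v A B, A ⊆ Finset.univ.filter (fun e => head e = v) →
    B ⊆ Finset.univ.filter (fun e => head e = v) →
    rhoM v (A ∪ B) + rhoM v (A ∩ B) ≤ rhoM v A + rhoM v B
  rhoP_submod : ∀ v A B, A ⊆ Finset.univ.filter (fun e => tail e = v) →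
    B ⊆ Finset.univ.filter (fun e => tail e = v) →
    rhoP v (A ∪ B) + rhoP v (A ∩ B) ≤ rhoP v A + rhoP v B

namespace DirPolyNet

variable {V E : Type} [Fintype V] [Fintype E] [DecidableEq V] [DecidableEq E]

/-- The set of edges entering `v` (the ground set of `rhoM v`). -/
def inE (N : DirPolyNet V E) (v : V) : Finset E :=
  Finset.univ.filter (fun e => N.head e = v)

/-- The set of edges leaving `v` (the ground set of `rhoP v`). -/
def outE (N : DirPolyNet V E) (v : V) : Finset E :=
  Finset.univ.filter (fun e => N.tail e = v)

/-- `g` is a valid assignment of the edges of `F` to endpoints. -/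
def Valid (N : DirPolyNet V E) (F : Finset E) (g : E → V) : Prop :=
  ∀ e ∈ F, g e = N.tail e ∨ g e = N.head e

/-- The cost `ν(F)` of the edge cut `F`: the minimum over valid assignments `g`
of `Σ_v (ρ⁻_v(δ⁻(v) ∩ g⁻¹(v)) + ρ⁺_v(δ⁺(v) ∩ g⁻¹(v)))`. -/
noncomputable def cutCost (N : DirPolyNet V E) (F : Finset E) : ℝ :=
  sInf { c : ℝ | ∃ g : E → V, N.Valid F g ∧
    c = ∑ v : V, (N.rhoM v ((N.inE v ∩ F).filter (fun e => g e = v)) +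
                  N.rhoP v ((N.outE v ∩ F).filter (fun e => g e = v))) }

/-- `IsWalk N s t p`: the list of edges `p` forms a directed walk from `s` to `t`. -/
def IsWalk (N : DirPolyNet V E) : V → V → List E → Prop
  | s, t, [] => s = t
  | s, t, e :: p => N.tail e = s ∧ IsWalk N (N.head e) t p

/-- The list of vertices visited by a walk starting at `s`. -/
def walkVerts (N : DirPolyNet V E) : V → List E → List V
  | s, [] => [s]
  | s, e :: p => s :: walkVerts N (N.head e) p

/-- A simple directed path from `s` to `t`. -/
def IsPath (N : DirPolyNet V E) (s t : V) (p : List E) : Prop :=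
  N.IsWalk s t p ∧ (N.walkVerts s p).Nodup

/-- `F` separates the ordered pair `(s,t)`: there is no `s→t` path avoiding `F`. -/
def Separates (N : DirPolyNet V E) (F : Finset E) (s t : V) : Prop :=
  ¬ ∃ p : List E, N.IsWalk s t p ∧ ∀ e ∈ p, e ∉ F

/-- Total flow on an edge `e`. -/
noncomputable def edgeFlow (N : DirPolyNet V E) {ι : Type} [Fintype ι]
    (f : ι → List E → ℝ) (e : E) : ℝ :=
  ∑ i : ι, ∑ᶠ p ∈ {p : List E | e ∈ p}, f i p

/-- The rate of commodity `i`. -/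
noncomputable def rate {ι : Type} (f : ι → List E → ℝ) (i : ι) : ℝ :=
  ∑ᶠ p : List E, f i p

/-- A feasible multicommodity flow for the source-sink pairs `(s i, t i)`. -/
structure IsFlow (N : DirPolyNet V E) {ι : Type} [Fintype ι] (s t : ι → V)
    (f : ι → List E → ℝ) : Prop where
  nonneg : ∀ i p, 0 ≤ f i p
  supp : ∀ i p, f i p ≠ 0 → N.IsPath (s i) (t i) p
  fin : ∀ i, (Function.support (f i)).Finite
  capM : ∀ v, ∀ S ⊆ N.inE v, ∑ e ∈ S, N.edgeFlow f e ≤ N.rhoM v S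
  capP : ∀ v, ∀ S ⊆ N.outE v, ∑ e ∈ S, N.edgeFlow f e ≤ N.rhoP v S

/-- `D(F)`: the total demand of the pairs separated by `F`. -/
noncomputable def sepDemand (N : DirPolyNet V E) {ι : Type} [Fintype ι]
    (s t : ι → V) (D : ι → ℝ) (F : Finset E) : ℝ :=
  ∑ i : ι, if N.Separates F (s i) (t i) then D i else 0

/-- The value of the maximum throughput multicommodity flow. -/
noncomputable def maxThroughput (N : DirPolyNet V E) {ι : Type} [Fintype ι]
    (s t : ι → V) : ℝ :=
  sSup { r : ℝ | ∃ f : ι → List E → ℝ, N.IsFlow s t f ∧ r = ∑ i : ι, rate f i }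

/-- The value of the maximum concurrent multicommodity flow for demands `D`. -/
noncomputable def maxConcurrent (N : DirPolyNet V E) {ι : Type} [Fintype ι]
    (s t : ι → V) (D : ι → ℝ) : ℝ :=
  sSup { lam : ℝ | ∃ f : ι → List E → ℝ, N.IsFlow s t f ∧ ∀ i, rate f i = lam * D i }

end DirPolyNet

namespace DirPolyNet

variable {V E : Type} [Fintype V] [Fintype E] [DecidableEq V] [DecidableEq E]

/-- Maximum throughput flow for symmetric demands: the `2k` ordered pairs
`(s i, t i)` and `(t i, s i)` are routed with equal rates, maximizing `Σ (R i + R' i)`. -/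
noncomputable def maxThroughputSym (N : DirPolyNet V E) {k : ℕ}
    (s t : Fin k → V) : ℝ :=
  sSup { r : ℝ | ∃ f : (Fin k ⊕ Fin k) → List E → ℝ,
    N.IsFlow (Sum.elim s t) (Sum.elim t s) f ∧
    (∀ i : Fin k, rate f (Sum.inl i) = rate f (Sum.inr i)) ∧
    r = ∑ j : Fin k ⊕ Fin k, rate f j }

end DirPolyNet

open DirPolyNet

/-- `ρ` is a polymatroid on the ground set `S`; nonnegativity is implied. -/
structure IsPolymatroidOn {E : Type} [DecidableEq E] (S : Finset E) (ρ : Finset E → ℝ) : Prop where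
  empty : ρ ∅ = 0
  mono : ∀ A B, A ⊆ B → B ⊆ S → ρ A ≤ ρ B
  submod : ∀ A B, A ⊆ S → B ⊆ S → ρ (A ∪ B) + ρ (A ∩ B) ≤ ρ A + ρ B

/-- The value of `ρ` on the superlevel set `{e ∈ S | θ ≤ l e}` for `θ ≥ 0`, extended by zero. -/
noncomputable def levelValue {E : Type} [DecidableEq E] (S : Finset E) (ρ : Finset E → ℝ)
    (l : E → ℝ) (θ : ℝ) : ℝ :=
  if 0 ≤ θ then ρ (S.filter (fun e => θ ≤ l e)) else 0

/-- The Lovász extension of `ρ`, evaluated at a nonnegative vector `l`. -/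
noncomputable def lovasz {E : Type} [DecidableEq E] (S : Finset E) (ρ : Finset E → ℝ)
    (l : E → ℝ) : ℝ :=
  ∫ θ, levelValue S ρ l θ

namespace IsPolymatroidOn

variable {E : Type} [DecidableEq E] {S : Finset E} {ρ : Finset E → ℝ}

lemma nonneg (h : IsPolymatroidOn S ρ) {A : Finset E} (hA : A ⊆ S) : 0 ≤ ρ A := by
  have := h.mono ∅ A (Finset.empty_subset _) hA
  rwa [h.empty] at this

lemma union_le (h : IsPolymatroidOn S ρ) {A B : Finset E} (hA : A ⊆ S) (hB : B ⊆ S) :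
    ρ (A ∪ B) ≤ ρ A + ρ B := by
  have h1 := h.submod A B hA hB
  have h2 := h.nonneg (Finset.inter_subset_left.trans hA : A ∩ B ⊆ S)
  linarith

lemma restrict (h : IsPolymatroidOn S ρ) {T : Finset E} (hT : T ⊆ S) : IsPolymatroidOn T ρ :=
  ⟨h.empty, fun A B hAB hB => h.mono A B hAB (hB.trans hT),
    fun A B hA hB => h.submod A B (hA.trans hT) (hB.trans hT)⟩

lemma levelValue_nonneg (h : IsPolymatroidOn S ρ) (l : E → ℝ) (θ : ℝ) :
    0 ≤ levelValue S ρ l θ := by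
  unfold levelValue
  split_ifs
  · exact h.nonneg (Finset.filter_subset _ _)
  · exact le_rfl

lemma antitone_filter (h : IsPolymatroidOn S ρ) (l : E → ℝ) :
    Antitone fun θ : ℝ => ρ (S.filter (fun e => θ ≤ l e)) := by
  intro a b hab
  refine h.mono _ _ (fun e he => ?_) (Finset.filter_subset _ _)
  rw [Finset.mem_filter] at he ⊢
  exact ⟨he.1, hab.trans he.2⟩

lemma integrable_levelValue (h : IsPolymatroidOn S ρ) (l : E → ℝ) :
    Integrable (levelValue S ρ l) := by
  set M : ℝ := ∑ e ∈ S, |l e|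
  have hM : ∀ e ∈ S, l e ≤ M := fun e he =>
    (le_abs_self _).trans (Finset.single_le_sum (f := fun e => |l e|) (fun _ _ => abs_nonneg _) he)
  have heq : levelValue S ρ l =
      Set.indicator (Set.Icc 0 M) fun θ : ℝ => ρ (S.filter (fun e => θ ≤ l e)) := by
    funext θ
    unfold levelValue
    by_cases h0 : 0 ≤ θ
    · by_cases h1 : θ ≤ M
      · rw [if_pos h0, Set.indicator_of_mem (Set.mem_Icc.2 ⟨h0, h1⟩)]
      · rw [if_pos h0, Set.indicator_of_notMem (fun hm => h1 hm.2), Finset.filter_false_of_mem,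
          h.empty]
        intro e he hle
        exact h1 (hle.trans (hM e he))
    · rw [if_neg h0, Set.indicator_of_notMem (fun hm => h0 hm.1)]
  rw [heq, integrable_indicator_iff measurableSet_Icc]
  exact (h.antitone_filter l).antitoneOn _ |>.integrableOn_isCompact isCompact_Icc

lemma lovasz_nonneg (h : IsPolymatroidOn S ρ) (l : E → ℝ) : 0 ≤ lovasz S ρ l :=
  integral_nonneg (h.levelValue_nonneg l)

lemma lovasz_zero (h : IsPolymatroidOn S ρ) : lovasz S ρ (fun _ => 0) = 0 := by
  unfold lovasz
  rw [integral_eq_zero_of_ae]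
  have : ∀ᵐ θ : ℝ, θ ≠ 0 := by
    simp [ae_iff]
  filter_upwards [this] with θ hθ
  unfold levelValue
  by_cases h0 : 0 ≤ θ
  · rw [if_pos h0, Finset.filter_false_of_mem, h.empty]
    · rfl
    · intro e _ hle
      exact hθ (le_antisymm hle h0)
  · rw [if_neg h0]
    rfl

/-- A threshold inequality bounding `ρ` on a superlevel set by the Lovász extension. -/
lemma level_mul_le (h : IsPolymatroidOn S ρ) (l : E → ℝ) {ε : ℝ} (hε : 0 < ε) :
    ε * ρ (S.filter (fun e => ε ≤ l e)) ≤ lovasz S ρ l := by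
  set c := ρ (S.filter (fun e => ε ≤ l e)) with hc
  have h1 : ∫ θ, Set.indicator (Set.Icc 0 ε) (fun _ : ℝ => c) θ = ε * c := by
    rw [integral_indicator measurableSet_Icc]
    simp [hε.le]
  rw [← h1]
  refine integral_mono ?_ (h.integrable_levelValue l) ?_
  · rw [integrable_indicator_iff measurableSet_Icc]
    exact integrableOn_const (by simp) (by simp)
  · intro θ
    by_cases hm : θ ∈ Set.Icc 0 ε
    · rw [Set.indicator_of_mem hm]
      unfold levelValue
      rw [if_pos hm.1]
      exact h.antitone_filter l hm.2
    · rw [Set.indicator_of_notMem hm]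
      exact h.levelValue_nonneg l θ

lemma lovasz_add_indicator_le (h : IsPolymatroidOn S ρ) {l : E → ℝ} (hl : ∀ e, 0 ≤ l e)
    {T : Finset E} (hT : T ⊆ S) {c : ℝ} (hc : 0 ≤ c) :
    lovasz S ρ (fun e => l e + if e ∈ T then c else 0) ≤ lovasz S ρ l + c * ρ T := by
  have hT' := h.restrict hT
  have hi1 := h.integrable_levelValue l
  have hi2 := hT'.integrable_levelValue l
  have hi3 : Integrable fun θ : ℝ => levelValue T ρ l (θ - c) := hi2.comp_sub_right c
  have hi4 : Integrable (Set.indicator (Set.Ico 0 c) fun _ : ℝ => ρ T) := by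
    rw [integrable_indicator_iff measurableSet_Ico]
    exact integrableOn_const (by simp) (by simp)
  have hi6 : Integrable fun θ : ℝ => levelValue T ρ l (θ - c) - levelValue T ρ l θ := hi3.sub hi2
  have hi5 : Integrable fun θ : ℝ => levelValue S ρ l θ +
      (levelValue T ρ l (θ - c) - levelValue T ρ l θ) := hi1.add hi6
  have h4 : ∫ θ, Set.indicator (Set.Ico 0 c) (fun _ : ℝ => ρ T) θ = c * ρ T := by
    rw [integral_indicator measurableSet_Ico]
    simp [hc]
  have h3 : ∫ θ, levelValue T ρ l (θ - c) = ∫ θ, levelValue T ρ l θ :=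
    integral_sub_right_eq_self _ c
  have hsum : ∫ θ, (levelValue S ρ l θ + (levelValue T ρ l (θ - c) - levelValue T ρ l θ) +
      Set.indicator (Set.Ico 0 c) (fun _ : ℝ => ρ T) θ) = lovasz S ρ l + c * ρ T := by
    rw [integral_add hi5 hi4, integral_add hi1 hi6, integral_sub hi3 hi2, h3, h4]
    simp [lovasz]
  rw [← hsum]
  refine integral_mono (h.integrable_levelValue _) (hi5.add hi4) ?_
  intro θ
  by_cases h0 : 0 ≤ θ
  · have hset : (S.filter fun e => θ ≤ l e + if e ∈ T then c else 0) =
        (S.filter fun e => θ ≤ l e) ∪ (T.filter fun e => θ - c ≤ l e) := by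
      ext e
      simp only [Finset.mem_filter, Finset.mem_union]
      constructor
      · rintro ⟨h1, h2⟩
        by_cases he : e ∈ T
        · rw [if_pos he] at h2
          exact Or.inr ⟨he, by linarith⟩
        · rw [if_neg he] at h2
          exact Or.inl ⟨h1, by linarith⟩
      · rintro (⟨h1, h2⟩ | ⟨h1, h2⟩)
        · refine ⟨h1, ?_⟩
          split_ifs <;> linarith
        · refine ⟨hT h1, ?_⟩
          rw [if_pos h1]
          linarith
    have hint : (S.filter fun e => θ ≤ l e) ∩ (T.filter fun e => θ - c ≤ l e) =
        T.filter fun e => θ ≤ l e := by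
      ext e
      simp only [Finset.mem_filter, Finset.mem_inter]
      constructor
      · rintro ⟨h1, h2⟩
        exact ⟨h2.1, h1.2⟩
      · rintro ⟨h1, h2⟩
        exact ⟨⟨hT h1, h2⟩, h1, by linarith⟩
    have hsub := h.submod (S.filter fun e => θ ≤ l e) (T.filter fun e => θ - c ≤ l e)
      (Finset.filter_subset _ _) ((Finset.filter_subset _ _).trans hT)
    rw [hint, ← hset] at hsub
    have hlast : ρ (T.filter fun e => θ - c ≤ l e) =
        levelValue T ρ l (θ - c) + Set.indicator (Set.Ico 0 c) (fun _ : ℝ => ρ T) θ := by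
      unfold levelValue
      by_cases h1 : θ < c
      · rw [if_neg (by linarith), Set.indicator_of_mem (Set.mem_Ico.2 ⟨h0, h1⟩), zero_add,
          Finset.filter_true_of_mem]
        intro e _
        linarith [hl e]
      · rw [if_pos (by linarith), Set.indicator_of_notMem (fun hm => h1 hm.2), add_zero]
    rw [hlast] at hsub
    have e1 : levelValue S ρ l θ = ρ (S.filter fun e => θ ≤ l e) := if_pos h0
    have e2 : levelValue T ρ l θ = ρ (T.filter fun e => θ ≤ l e) := if_pos h0
    have e3 : levelValue S ρ (fun e => l e + if e ∈ T then c else 0) θ =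
      ρ (S.filter fun e => θ ≤ l e + if e ∈ T then c else 0) := if_pos h0
    simp only
    rw [e1, e2, e3]
    linarith
  · have e1 : levelValue S ρ l θ = 0 := if_neg h0
    have e2 : levelValue T ρ l θ = 0 := if_neg h0
    have e3 : levelValue S ρ (fun e => l e + if e ∈ T then c else 0) θ = 0 := if_neg h0
    simp only
    rw [e1, e2, e3]
    have := hT'.levelValue_nonneg l (θ - c)
    have h5 : 0 ≤ Set.indicator (Set.Ico 0 c) (fun _ : ℝ => ρ T) θ :=
      Set.indicator_nonneg (fun _ _ => h.nonneg hT) θ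
    linarith

/-- The Lovász extension is at most the cost of any decomposition into indicator vectors. -/
lemma lovasz_le_sum (h : IsPolymatroidOn S ρ) (y : Finset E → ℝ) (hy : ∀ T, 0 ≤ y T)
    (𝒯 : Finset (Finset E)) (h𝒯 : ∀ T ∈ 𝒯, T ⊆ S) :
    lovasz S ρ (fun e => ∑ T ∈ 𝒯, if e ∈ T then y T else 0) ≤ ∑ T ∈ 𝒯, y T * ρ T := by
  induction 𝒯 using Finset.induction_on with
  | empty => simpa using h.lovasz_zero.le
  | insert T 𝒯 hT ih =>
    have h1 := ih fun T' hT' => h𝒯 T' (Finset.mem_insert_of_mem hT')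
    have h2 := h.lovasz_add_indicator_le (l := fun e => ∑ T ∈ 𝒯, if e ∈ T then y T else 0)
      (fun e => Finset.sum_nonneg fun T' _ => by split_ifs <;> simp [hy])
      (h𝒯 T (Finset.mem_insert_self _ _)) (hy T)
    simp only [Finset.sum_insert hT]
    have h3 : (fun e => (if e ∈ T then y T else 0) + ∑ T ∈ 𝒯, if e ∈ T then y T else 0) =
        fun e => (∑ T ∈ 𝒯, if e ∈ T then y T else 0) + if e ∈ T then y T else 0 := by
      funext e
      ring
    rw [h3]
    linarith

/-- Mass of the level function over a translated window. -/
lemma setIntegral_levelValue_sub_le (h : IsPolymatroidOn S ρ) (l : E → ℝ) (c : ℝ) (I : Set ℝ) :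
    IntegrableOn (fun r => levelValue S ρ l (r - c)) I ∧
      ∫ r in I, levelValue S ρ l (r - c) ≤ lovasz S ρ l := by
  have hi : Integrable fun r : ℝ => levelValue S ρ l (r - c) :=
    (h.integrable_levelValue l).comp_sub_right c
  refine ⟨hi.integrableOn, ?_⟩
  refine (setIntegral_le_integral hi (.of_forall fun r => h.levelValue_nonneg l _)).trans_eq ?_
  exact integral_sub_right_eq_self _ c

lemma setIntegral_levelValue_sub_le' (h : IsPolymatroidOn S ρ) (l : E → ℝ) (c : ℝ) (I : Set ℝ) :
    IntegrableOn (fun r => levelValue S ρ l (c - r)) I ∧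
      ∫ r in I, levelValue S ρ l (c - r) ≤ lovasz S ρ l := by
  have hi : Integrable fun r : ℝ => levelValue S ρ l (c - r) :=
    (h.integrable_levelValue l).comp_sub_left c
  refine ⟨hi.integrableOn, ?_⟩
  refine (setIntegral_le_integral hi (.of_forall fun r => h.levelValue_nonneg l _)).trans_eq ?_
  exact integral_sub_left_eq_self _ volume c

end IsPolymatroidOn

/-- Farkas' lemma for finitely many linear functionals on a real vector space. -/
lemma exists_nonneg_combination {W : Type*} [AddCommGroup W] [Module ℝ W] {ι : Type*}
    (I : Finset ι) :
    ∀ (a : ι → W →ₗ[ℝ] ℝ) (b : W →ₗ[ℝ] ℝ), (∀ x, (∀ i ∈ I, 0 ≤ a i x) → 0 ≤ b x) →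
      ∃ u : ι → ℝ, (∀ i, 0 ≤ u i) ∧ ∀ x, b x = ∑ i ∈ I, u i * a i x := by
  induction I using Finset.induction_on with
  | empty =>
    intro a b h
    refine ⟨fun _ => 0, fun _ => le_rfl, fun x => ?_⟩
    have h1 := h x (by simp)
    have h2 := h (-x) (by simp)
    rw [map_neg] at h2
    simp
    linarith
  | insert j I hj ih =>
    intro a b h
    by_cases hI : ∀ x, (∀ i ∈ I, 0 ≤ a i x) → 0 ≤ b x
    · obtain ⟨u, hu, hx⟩ := ih a b hI
      refine ⟨fun i => if i = j then 0 else u i, fun i => ?_, fun x => ?_⟩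
      · simp only
        split_ifs
        · exact le_rfl
        · exact hu i
      · rw [Finset.sum_insert hj, hx x]
        simp only [if_true, zero_mul, zero_add]
        refine Finset.sum_congr rfl fun i hi => ?_
        rw [if_neg (ne_of_mem_of_not_mem hi hj)]
    · push Not at hI
      obtain ⟨x₀, hx₀, hb₀⟩ := hI
      have hj₀ : a j x₀ < 0 := by
        by_contra hcon
        push Not at hcon
        refine absurd (h x₀ fun i hi => ?_) (not_le.2 hb₀)
        rcases Finset.mem_insert.1 hi with rfl | hi
        · exact hcon
        · exact hx₀ i hi
      set x₁ : W := (-(a j x₀)⁻¹) • x₀ with hx₁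
      have hpos : 0 < -(a j x₀)⁻¹ := by
        rw [neg_pos]
        exact inv_lt_zero.2 hj₀
      have h1 : a j x₁ = -1 := by
        rw [hx₁, map_smul, smul_eq_mul, neg_mul, inv_mul_cancel₀ hj₀.ne]
      have h2 : ∀ i ∈ I, 0 ≤ a i x₁ := fun i hi => by
        rw [hx₁, map_smul, smul_eq_mul]
        exact mul_nonneg hpos.le (hx₀ i hi)
      have h3 : b x₁ < 0 := by
        rw [hx₁, map_smul, smul_eq_mul]
        exact mul_neg_of_pos_of_neg hpos hb₀
      obtain ⟨u, hu, hx⟩ := ih (fun i => a i + (a i x₁) • a j) (b + (b x₁) • a j) (by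
        intro x hx
        have hy := h (x + (a j x) • x₁) (by
          intro i hi
          rcases Finset.mem_insert.1 hi with rfl | hi
          · simp [h1]
          · have := hx i hi
            simp only [LinearMap.add_apply, LinearMap.smul_apply, smul_eq_mul] at this
            simp only [map_add, map_smul, smul_eq_mul]
            linarith)
        simp only [map_add, map_smul, smul_eq_mul] at hy
        simp only [LinearMap.add_apply, LinearMap.smul_apply, smul_eq_mul]
        linarith)
      refine ⟨fun i => if i = j then ∑ i ∈ I, u i * a i x₁ - b x₁ else u i, fun i => ?_,
        fun x => ?_⟩
      · simp only
        split_ifs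
        · have := Finset.sum_nonneg fun i hi => mul_nonneg (hu i) (h2 i hi)
          linarith
        · exact hu i
      · have hxx := hx x
        simp only [LinearMap.add_apply, LinearMap.smul_apply, smul_eq_mul, mul_add,
          Finset.sum_add_distrib] at hxx
        rw [Finset.sum_insert hj]
        simp only [if_true]
        have e1 : ∑ i ∈ I, (if i = j then ∑ i ∈ I, u i * a i x₁ - b x₁ else u i) * a i x =
            ∑ i ∈ I, u i * a i x := by
          refine Finset.sum_congr rfl fun i hi => ?_
          rw [if_neg (ne_of_mem_of_not_mem hi hj)]
        have e2 : ∑ i ∈ I, u i * (a i x₁ * a j x) = (∑ i ∈ I, u i * a i x₁) * a j x := by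
          rw [Finset.sum_mul]
          exact Finset.sum_congr rfl fun i _ => by ring
        rw [e1]
        rw [e2] at hxx
        linarith

namespace DirPolyNet

lemma rate_eq_sum {E ι : Type} (f : ι → List E → ℝ) (P : ι → Finset (List E))
    (h : ∀ j p, f j p ≠ 0 → p ∈ P j) (j : ι) : rate f j = ∑ p ∈ P j, f j p :=
  finsum_eq_sum_of_support_subset _ fun p hp => h j p hp

variable {V E : Type} [Fintype V] [Fintype E] [DecidableEq V] [DecidableEq E]

lemma mem_inE (N : DirPolyNet V E) {v : V} {e : E} : e ∈ N.inE v ↔ N.head e = v := by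
  simp [inE]

lemma mem_outE (N : DirPolyNet V E) {v : V} {e : E} : e ∈ N.outE v ↔ N.tail e = v := by
  simp [outE]

lemma isPolymatroidOn_rhoM (N : DirPolyNet V E) (v : V) :
    IsPolymatroidOn (N.inE v) (N.rhoM v) :=
  ⟨N.rhoM_empty v, N.rhoM_mono v, N.rhoM_submod v⟩

lemma isPolymatroidOn_rhoP (N : DirPolyNet V E) (v : V) :
    IsPolymatroidOn (N.outE v) (N.rhoP v) :=
  ⟨N.rhoP_empty v, N.rhoP_mono v, N.rhoP_submod v⟩

lemma length_walkVerts (N : DirPolyNet V E) (s : V) (p : List E) :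
    (N.walkVerts s p).length = p.length + 1 := by
  induction p generalizing s with
  | nil => rfl
  | cons e p ih => simp [walkVerts, ih]

lemma finite_isPath (N : DirPolyNet V E) (s t : V) : {p | N.IsPath s t p}.Finite := by
  refine (List.finite_length_le E (Fintype.card V)).subset fun p hp => ?_
  have := hp.2.length_le_card
  rw [length_walkVerts] at this
  simp only [Set.mem_ofPred_eq]
  omega

lemma IsWalk.ne_nil {N : DirPolyNet V E} {s t : V} {p : List E} (h : N.IsWalk s t p)
    (hst : s ≠ t) : p ≠ [] := by
  rintro rfl
  exact hst h

lemma edgeFlow_eq_sum (N : DirPolyNet V E) {ι : Type} [Fintype ι] (f : ι → List E → ℝ)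
    (P : ι → Finset (List E)) (h : ∀ j p, f j p ≠ 0 → p ∈ P j) (e : E) :
    N.edgeFlow f e = ∑ j, ∑ p ∈ P j, if e ∈ p then f j p else 0 := by
  unfold edgeFlow
  refine Finset.sum_congr rfl fun j _ => ?_
  rw [finsum_mem_def, finsum_eq_sum_of_support_subset (s := P j)]
  · refine Finset.sum_congr rfl fun p _ => ?_
    simp [Set.indicator_apply]
  · intro p hp
    refine h j p fun h0 => hp ?_
    simp [Set.indicator_apply, h0]

/-- Every unit of flow on a nonempty path is counted by some edge. -/
lemma sum_le_sum_edge {ι : Type} [Fintype ι] (x : ι → List E → ℝ) (P : ι → Finset (List E))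
    (hx : ∀ j, ∀ p ∈ P j, 0 ≤ x j p) (hP : ∀ j, ∀ p ∈ P j, p ≠ []) :
    ∑ j, ∑ p ∈ P j, x j p ≤ ∑ e : E, ∑ j, ∑ p ∈ P j, if e ∈ p then x j p else 0 := by
  rw [Finset.sum_comm]
  refine Finset.sum_le_sum fun j _ => ?_
  rw [Finset.sum_comm]
  refine Finset.sum_le_sum fun p hp => ?_
  obtain ⟨e, he⟩ := List.exists_mem_of_ne_nil p (hP j p hp)
  calc x j p = if e ∈ p then x j p else 0 := by rw [if_pos he]
    _ ≤ _ := Finset.single_le_sum (f := fun e => if e ∈ p then x j p else 0)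
      (fun e _ => by split_ifs <;> simp [hx j p hp]) (Finset.mem_univ e)

/-- The commodity paths used in a symmetric instance. -/
noncomputable def symPaths (N : DirPolyNet V E) {k : ℕ} (s t : Fin k → V)
    (j : Fin k ⊕ Fin k) : Finset (List E) :=
  (N.finite_isPath (Sum.elim s t j) (Sum.elim t s j)).toFinset

lemma mem_symPaths (N : DirPolyNet V E) {k : ℕ} {s t : Fin k → V} {j : Fin k ⊕ Fin k}
    {p : List E} :
    p ∈ N.symPaths s t j ↔ N.IsPath (Sum.elim s t j) (Sum.elim t s j) p := by
  simp [symPaths]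

lemma symPaths_ne_nil (N : DirPolyNet V E) {k : ℕ} {s t : Fin k → V} (hst : ∀ i, s i ≠ t i)
    (j : Fin k ⊕ Fin k) : ∀ p ∈ N.symPaths s t j, p ≠ [] := by
  intro p hp
  refine (N.mem_symPaths.1 hp).1.ne_nil ?_
  cases j with
  | inl i => exact hst i
  | inr i => exact (hst i).symm

lemma bddAbove_throughputSym (N : DirPolyNet V E) {k : ℕ} (s t : Fin k → V)
    (hst : ∀ i, s i ≠ t i) :
    BddAbove { r : ℝ | ∃ f : (Fin k ⊕ Fin k) → List E → ℝ,
      N.IsFlow (Sum.elim s t) (Sum.elim t s) f ∧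
      (∀ i : Fin k, rate f (Sum.inl i) = rate f (Sum.inr i)) ∧
      r = ∑ j : Fin k ⊕ Fin k, rate f j } := by
  refine ⟨∑ e : E, N.rhoM (N.head e) {e}, ?_⟩
  rintro r ⟨f, hf, -, rfl⟩
  have hP : ∀ j p, f j p ≠ 0 → p ∈ N.symPaths s t j := fun j p h =>
    N.mem_symPaths.2 (hf.supp j p h)
  simp only [rate_eq_sum f _ hP]
  refine (sum_le_sum_edge f _ (fun j p _ => hf.nonneg j p) (N.symPaths_ne_nil hst)).trans ?_
  refine Finset.sum_le_sum fun e _ => ?_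
  rw [← N.edgeFlow_eq_sum f _ hP]
  simpa using hf.capM (N.head e) {e} (by simp [mem_inE])

lemma throughputSym_nonneg (N : DirPolyNet V E) {k : ℕ} (s t : Fin k → V) :
    0 ≤ N.maxThroughputSym s t := by
  refine Real.sSup_nonneg ?_
  rintro r ⟨f, hf, -, rfl⟩
  exact Finset.sum_nonneg fun j _ => finsum_nonneg fun p => hf.nonneg j p

/-- A nonnegative path vector within the capacities yields a bound on the throughput. -/
lemma sum_le_throughputSym (N : DirPolyNet V E) {k : ℕ} (s t : Fin k → V)
    (hst : ∀ i, s i ≠ t i) (x : (Fin k ⊕ Fin k) → List E → ℝ)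
    (hx : ∀ j, ∀ p ∈ N.symPaths s t j, 0 ≤ x j p)
    (hM : ∀ v, ∀ S ⊆ N.inE v, ∑ e ∈ S, ∑ j, ∑ p ∈ N.symPaths s t j,
      (if e ∈ p then x j p else 0) ≤ N.rhoM v S)
    (hP : ∀ v, ∀ S ⊆ N.outE v, ∑ e ∈ S, ∑ j, ∑ p ∈ N.symPaths s t j,
      (if e ∈ p then x j p else 0) ≤ N.rhoP v S)
    (heq : ∀ i : Fin k, ∑ p ∈ N.symPaths s t (Sum.inl i), x (Sum.inl i) p =
      ∑ p ∈ N.symPaths s t (Sum.inr i), x (Sum.inr i) p) :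
    ∑ j, ∑ p ∈ N.symPaths s t j, x j p ≤ N.maxThroughputSym s t := by
  set f : (Fin k ⊕ Fin k) → List E → ℝ := fun j p => if p ∈ N.symPaths s t j then x j p else 0
    with hf
  have hfP : ∀ j p, f j p ≠ 0 → p ∈ N.symPaths s t j := by
    intro j p h
    by_contra hcon
    exact h (if_neg hcon)
  have hr : ∀ j, rate f j = ∑ p ∈ N.symPaths s t j, x j p := fun j => by
    rw [rate_eq_sum f _ hfP]
    exact Finset.sum_congr rfl fun p hp => if_pos hp
  have he : ∀ e, N.edgeFlow f e = ∑ j, ∑ p ∈ N.symPaths s t j, if e ∈ p then x j p else 0 :=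
    fun e => by
      rw [N.edgeFlow_eq_sum f _ hfP]
      refine Finset.sum_congr rfl fun j _ => Finset.sum_congr rfl fun p hp => ?_
      simp [hf, hp]
  refine le_csSup (N.bddAbove_throughputSym s t hst) ⟨f, ⟨fun j p => ?_, fun j p h => ?_,
    fun j => ?_, ?_, ?_⟩, ?_, ?_⟩
  · simp only [hf]
    split_ifs with h
    · exact hx j p h
    · exact le_rfl
  · exact N.mem_symPaths.1 (hfP j p h)
  · exact (N.symPaths s t j).finite_toSet.subset fun p hp => hfP j p hp
  · intro v S hS
    simp only [he]
    exact hM v S hS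
  · intro v S hS
    simp only [he]
    exact hP v S hS
  · intro i
    rw [hr, hr, heq]
  · simp only [hr]

/-- Dual variables for the maximum throughput linear program with symmetric demands. -/
lemma exists_dual (N : DirPolyNet V E) {k : ℕ} (s t : Fin k → V) (hst : ∀ i, s i ≠ t i) :
    ∃ (yM yP : V → Finset E → ℝ) (z : Fin k → ℝ),
      (∀ v S, 0 ≤ yM v S) ∧ (∀ v S, 0 ≤ yP v S) ∧
      ∀ (x : (Fin k ⊕ Fin k) → List E → ℝ) (τ : ℝ), (∀ j p, 0 ≤ x j p) → 0 ≤ τ →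
        (∑ v, ∑ S ∈ (N.inE v).powerset, yM v S * (N.rhoM v S * τ -
            ∑ e ∈ S, ∑ j, ∑ p ∈ N.symPaths s t j, if e ∈ p then x j p else 0)) +
          (∑ v, ∑ S ∈ (N.outE v).powerset, yP v S * (N.rhoP v S * τ -
            ∑ e ∈ S, ∑ j, ∑ p ∈ N.symPaths s t j, if e ∈ p then x j p else 0)) +
          ∑ i, z i * (∑ p ∈ N.symPaths s t (Sum.inl i), x (Sum.inl i) p -
            ∑ p ∈ N.symPaths s t (Sum.inr i), x (Sum.inr i) p) ≤
        N.maxThroughputSym s t * τ - ∑ j, ∑ p ∈ N.symPaths s t j, x j p := by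
  set P := N.symPaths s t with hPdef
  let W := ((Fin k ⊕ Fin k) → List E → ℝ) × ℝ
  let X : (Fin k ⊕ Fin k) → List E → (W →ₗ[ℝ] ℝ) := fun j p =>
    (LinearMap.proj p : (List E → ℝ) →ₗ[ℝ] ℝ).comp
      ((LinearMap.proj j : ((Fin k ⊕ Fin k) → List E → ℝ) →ₗ[ℝ] (List E → ℝ)).comp
        (LinearMap.fst ℝ _ _))
  let T : W →ₗ[ℝ] ℝ := LinearMap.snd ℝ _ _
  let R : (Fin k ⊕ Fin k) → (W →ₗ[ℝ] ℝ) := fun j => ∑ p ∈ P j, X j p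
  let Fl : E → (W →ₗ[ℝ] ℝ) := fun e => ∑ j, ∑ p ∈ P j, if e ∈ p then X j p else 0
  have hR : ∀ j (w : W), R j w = ∑ p ∈ P j, w.1 j p := fun j w => by
    simp only [R, LinearMap.sum_apply]
    rfl
  have hFl : ∀ e (w : W), Fl e w = ∑ j, ∑ p ∈ P j, if e ∈ p then w.1 j p else 0 := fun e w => by
    simp only [Fl, LinearMap.sum_apply]
    refine Finset.sum_congr rfl fun j _ => Finset.sum_congr rfl fun p _ => ?_
    split_ifs <;> rfl
  let capM : V × Finset E → (W →ₗ[ℝ] ℝ) := fun c =>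
    if c.2 ⊆ N.inE c.1 then N.rhoM c.1 c.2 • T - ∑ e ∈ c.2, Fl e else 0
  let capP : V × Finset E → (W →ₗ[ℝ] ℝ) := fun c =>
    if c.2 ⊆ N.outE c.1 then N.rhoP c.1 c.2 • T - ∑ e ∈ c.2, Fl e else 0
  let a : ((Σ j, {p // p ∈ P j}) ⊕ Unit) ⊕ ((V × Finset E) ⊕ (V × Finset E)) ⊕
      (Fin k ⊕ Fin k) → (W →ₗ[ℝ] ℝ) :=
    Sum.elim (Sum.elim (fun q => X q.1 q.2.1) fun _ => T)
      (Sum.elim (Sum.elim capM capP)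
        (Sum.elim (fun i => R (Sum.inl i) - R (Sum.inr i))
          fun i => R (Sum.inr i) - R (Sum.inl i)))
  have hcapM : ∀ (w : W) v S, S ⊆ N.inE v → capM (v, S) w = N.rhoM v S * w.2 -
      ∑ e ∈ S, ∑ j, ∑ p ∈ P j, if e ∈ p then w.1 j p else 0 := by
    intro w v S hS
    simp only [capM, if_pos hS, LinearMap.sub_apply, LinearMap.smul_apply, LinearMap.sum_apply,
      hFl, smul_eq_mul]
    rfl
  have hcapP : ∀ (w : W) v S, S ⊆ N.outE v → capP (v, S) w = N.rhoP v S * w.2 -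
      ∑ e ∈ S, ∑ j, ∑ p ∈ P j, if e ∈ p then w.1 j p else 0 := by
    intro w v S hS
    simp only [capP, if_pos hS, LinearMap.sub_apply, LinearMap.smul_apply, LinearMap.sum_apply,
      hFl, smul_eq_mul]
    rfl
  obtain ⟨u, hu, hux⟩ := exists_nonneg_combination Finset.univ a
    (N.maxThroughputSym s t • T - ∑ j, R j) (by
      intro w hw
      have hx : ∀ j, ∀ p ∈ P j, 0 ≤ w.1 j p := fun j p hp =>
        hw (Sum.inl (Sum.inl ⟨j, p, hp⟩)) (Finset.mem_univ _)
      have hτ : 0 ≤ w.2 := hw (Sum.inl (Sum.inr ())) (Finset.mem_univ _)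
      have hM : ∀ v, ∀ S ⊆ N.inE v, ∑ e ∈ S, ∑ j, ∑ p ∈ P j,
          (if e ∈ p then w.1 j p else 0) ≤ N.rhoM v S * w.2 := fun v S hS => by
        have h1 : 0 ≤ capM (v, S) w := hw (Sum.inr (Sum.inl (Sum.inl (v, S)))) (Finset.mem_univ _)
        rw [hcapM w v S hS] at h1
        linarith
      have hP : ∀ v, ∀ S ⊆ N.outE v, ∑ e ∈ S, ∑ j, ∑ p ∈ P j,
          (if e ∈ p then w.1 j p else 0) ≤ N.rhoP v S * w.2 := fun v S hS => by
        have h1 : 0 ≤ capP (v, S) w := hw (Sum.inr (Sum.inl (Sum.inr (v, S)))) (Finset.mem_univ _)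
        rw [hcapP w v S hS] at h1
        linarith
      have heq : ∀ i, ∑ p ∈ P (Sum.inl i), w.1 (Sum.inl i) p =
          ∑ p ∈ P (Sum.inr i), w.1 (Sum.inr i) p := fun i => by
        have h1 : 0 ≤ (R (Sum.inl i) - R (Sum.inr i)) w :=
          hw (Sum.inr (Sum.inr (Sum.inl i))) (Finset.mem_univ _)
        have h2 : 0 ≤ (R (Sum.inr i) - R (Sum.inl i)) w :=
          hw (Sum.inr (Sum.inr (Sum.inr i))) (Finset.mem_univ _)
        rw [LinearMap.sub_apply, hR, hR] at h1 h2
        linarith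
      rw [LinearMap.sub_apply, LinearMap.smul_apply, LinearMap.sum_apply, smul_eq_mul, sub_nonneg]
      simp only [hR]
      change _ ≤ N.maxThroughputSym s t * w.2
      rcases hτ.eq_or_lt with h0 | h0
      · rw [← h0, mul_zero]
        refine (sum_le_sum_edge w.1 P hx (N.symPaths_ne_nil hst)).trans ?_
        refine Finset.sum_nonpos fun e _ => ?_
        have := hM (N.head e) {e} (by simp [mem_inE])
        rwa [Finset.sum_singleton, ← h0, mul_zero] at this
      · have key := N.sum_le_throughputSym s t hst (fun j p => w.2⁻¹ * w.1 j p)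
          (fun j p hp => mul_nonneg (inv_nonneg.2 hτ) (hx j p hp))
          (fun v S hS => by
            have := mul_le_mul_of_nonneg_left (hM v S hS) (inv_nonneg.2 hτ)
            simp only [Finset.mul_sum, mul_ite, mul_zero] at this
            refine this.trans_eq ?_
            field_simp)
          (fun v S hS => by
            have := mul_le_mul_of_nonneg_left (hP v S hS) (inv_nonneg.2 hτ)
            simp only [Finset.mul_sum, mul_ite, mul_zero] at this
            refine this.trans_eq ?_
            field_simp)
          (fun i => by rw [← Finset.mul_sum, ← Finset.mul_sum]; exact congrArg _ (heq i))
        simp only [← Finset.mul_sum] at key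
        rwa [inv_mul_le_iff₀ h0, mul_comm] at key)
  refine ⟨fun v S => u (Sum.inr (Sum.inl (Sum.inl (v, S)))),
    fun v S => u (Sum.inr (Sum.inl (Sum.inr (v, S)))),
    fun i => u (Sum.inr (Sum.inr (Sum.inl i))) - u (Sum.inr (Sum.inr (Sum.inr i))),
    fun v S => hu _, fun v S => hu _, fun x τ hx hτ => ?_⟩
  have key := hux (x, τ)
  rw [LinearMap.sub_apply, LinearMap.smul_apply, LinearMap.sum_apply, smul_eq_mul] at key
  simp only [hR] at key
  have hT : T (x, τ) = τ := rfl
  rw [hT] at key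
  rw [key]
  have hsum : ∑ i, u i * a i (x, τ) =
      (∑ q : (Σ j, {p // p ∈ P j}), u (Sum.inl (Sum.inl q)) * X q.1 q.2.1 (x, τ) +
        ∑ q : Unit, u (Sum.inl (Sum.inr q)) * T (x, τ)) +
      ((∑ v, ∑ S, u (Sum.inr (Sum.inl (Sum.inl (v, S)))) * capM (v, S) (x, τ) +
        ∑ v, ∑ S, u (Sum.inr (Sum.inl (Sum.inr (v, S)))) * capP (v, S) (x, τ)) +
      (∑ i, u (Sum.inr (Sum.inr (Sum.inl i))) * (R (Sum.inl i) - R (Sum.inr i)) (x, τ) +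
        ∑ i, u (Sum.inr (Sum.inr (Sum.inr i))) * (R (Sum.inr i) - R (Sum.inl i)) (x, τ))) := by
    rw [Fintype.sum_sum_type, Fintype.sum_sum_type, Fintype.sum_sum_type, Fintype.sum_sum_type,
      Fintype.sum_sum_type, Fintype.sum_prod_type, Fintype.sum_prod_type]
    rfl
  rw [hsum]
  have h1 : 0 ≤ ∑ q : (Σ j, {p // p ∈ P j}), u (Sum.inl (Sum.inl q)) * X q.1 q.2.1 (x, τ) :=
    Finset.sum_nonneg fun q _ => mul_nonneg (hu _) (hx _ _)
  have h2 : 0 ≤ ∑ q : Unit, u (Sum.inl (Sum.inr q)) * T (x, τ) :=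
    Finset.sum_nonneg fun q _ => mul_nonneg (hu _) hτ
  have h3 : ∀ v, ∑ S, u (Sum.inr (Sum.inl (Sum.inl (v, S)))) * capM (v, S) (x, τ) =
      ∑ S ∈ (N.inE v).powerset, u (Sum.inr (Sum.inl (Sum.inl (v, S)))) * (N.rhoM v S * τ -
            ∑ e ∈ S, ∑ j, ∑ p ∈ P j, if e ∈ p then x j p else 0) := by
    intro v
    symm
    rw [← Finset.sum_subset (Finset.subset_univ (N.inE v).powerset)]
    · refine Finset.sum_congr rfl fun S hS => ?_
      rw [hcapM _ _ _ (Finset.mem_powerset.1 hS)]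
    · intro S _ hS
      rw [Finset.mem_powerset] at hS
      simp [capM, hS]
  have h4 : ∀ v, ∑ S, u (Sum.inr (Sum.inl (Sum.inr (v, S)))) * capP (v, S) (x, τ) =
      ∑ S ∈ (N.outE v).powerset, u (Sum.inr (Sum.inl (Sum.inr (v, S)))) * (N.rhoP v S * τ -
            ∑ e ∈ S, ∑ j, ∑ p ∈ P j, if e ∈ p then x j p else 0) := by
    intro v
    symm
    rw [← Finset.sum_subset (Finset.subset_univ (N.outE v).powerset)]
    · refine Finset.sum_congr rfl fun S hS => ?_
      rw [hcapP _ _ _ (Finset.mem_powerset.1 hS)]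
    · intro S _ hS
      rw [Finset.mem_powerset] at hS
      simp [capP, hS]
  simp only [h3, h4]
  have h5 : ∑ i, (u (Sum.inr (Sum.inr (Sum.inl i))) - u (Sum.inr (Sum.inr (Sum.inr i)))) *
      (∑ p ∈ P (Sum.inl i), x (Sum.inl i) p - ∑ p ∈ P (Sum.inr i), x (Sum.inr i) p) =
      ∑ i, u (Sum.inr (Sum.inr (Sum.inl i))) * (R (Sum.inl i) - R (Sum.inr i)) (x, τ) +
      ∑ i, u (Sum.inr (Sum.inr (Sum.inr i))) * (R (Sum.inr i) - R (Sum.inl i)) (x, τ) := by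
    rw [← Finset.sum_add_distrib]
    refine Finset.sum_congr rfl fun i _ => ?_
    simp only [LinearMap.sub_apply, hR]
    ring
  rw [h5]
  linarith

end DirPolyNet

lemma lovasz_congr {E : Type} [DecidableEq E] {S : Finset E} {ρ : Finset E → ℝ} {l l' : E → ℝ}
    (h : ∀ e ∈ S, l e = l' e) : lovasz S ρ l = lovasz S ρ l' := by
  unfold lovasz
  congr 1
  funext θ
  unfold levelValue
  have : (S.filter fun e => θ ≤ l e) = S.filter fun e => θ ≤ l' e :=
    Finset.filter_congr fun e he => by rw [h e he]
  rw [this]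

lemma sum_toFinset_le_sum_map {E : Type} [DecidableEq E] {l : E → ℝ} (hl : ∀ e, 0 ≤ l e)
    (p : List E) : ∑ e ∈ p.toFinset, l e ≤ (p.map l).sum := by
  induction p with
  | nil => simp
  | cons e p ih =>
    rw [List.toFinset_cons, List.map_cons, List.sum_cons]
    by_cases he : e ∈ p.toFinset
    · rw [Finset.insert_eq_of_mem he]
      linarith [hl e]
    · rw [Finset.sum_insert he]
      linarith

namespace DirPolyNet

variable {V E : Type} [Fintype V] [Fintype E] [DecidableEq V] [DecidableEq E]

lemma IsPath.exists_suffix {N : DirPolyNet V E} {a s t : V} {p : List E} (h : N.IsPath a t p)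
    (hs : s ∈ N.walkVerts a p) : ∃ q, N.IsPath s t q ∧ q ⊆ p := by
  induction p generalizing a with
  | nil =>
    have : s = a := by simpa [walkVerts] using hs
    subst this
    exact ⟨[], h, List.Subset.refl _⟩
  | cons e p ih =>
    rcases List.mem_cons.1 hs with rfl | hs
    · exact ⟨_, h, List.Subset.refl _⟩
    · obtain ⟨q, hq, hsub⟩ := ih ⟨h.1.2, (List.nodup_cons.1 h.2).2⟩ hs
      exact ⟨q, hq, List.subset_cons_of_subset _ hsub⟩

lemma IsWalk.exists_isPath {N : DirPolyNet V E} {s t : V} {p : List E} (h : N.IsWalk s t p) :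
    ∃ q, N.IsPath s t q ∧ q ⊆ p := by
  induction p generalizing s with
  | nil => exact ⟨[], ⟨h, by simp [walkVerts]⟩, List.Subset.refl _⟩
  | cons e p ih =>
    obtain ⟨q, hq, hsub⟩ := ih h.2
    by_cases hs : s ∈ N.walkVerts (N.head e) q
    · obtain ⟨q', hq', hsub'⟩ := hq.exists_suffix hs
      exact ⟨q', hq', List.Subset.trans (List.Subset.trans hsub' hsub) (List.subset_cons_self _ _)⟩
    · exact ⟨e :: q, ⟨⟨h.1, hq.1⟩, List.nodup_cons.2 ⟨hs, hq.2⟩⟩,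
        List.cons_subset_cons _ hsub⟩

lemma IsWalk.append_edge {N : DirPolyNet V E} {s : V} {p : List E} {e : E}
    (h : N.IsWalk s (N.tail e) p) : N.IsWalk s (N.head e) (p ++ [e]) := by
  induction p generalizing s with
  | nil => exact ⟨Eq.symm h, rfl⟩
  | cons e' p ih => exact ⟨h.1, ih h.2⟩

/-- The contribution of the vertex `v` to the Lovász cost of the edge lengths `lM + lP`. -/
noncomputable def vertexCost (N : DirPolyNet V E) (lM lP : E → ℝ) (v : V) : ℝ :=
  lovasz (N.inE v) (N.rhoM v) lM + lovasz (N.outE v) (N.rhoP v) lP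

lemma vertexCost_nonneg (N : DirPolyNet V E) (lM lP : E → ℝ) (v : V) :
    0 ≤ N.vertexCost lM lP v :=
  add_nonneg ((N.isPolymatroidOn_rhoM v).lovasz_nonneg _)
    ((N.isPolymatroidOn_rhoP v).lovasz_nonneg _)

/-- Optimal dual edge lengths: their Lovász cost is at most the maximum throughput, and each
demand pair is at distance at least one in one of the two directions. -/
lemma exists_lengths (N : DirPolyNet V E) {k : ℕ} (s t : Fin k → V) (hst : ∀ i, s i ≠ t i) :
    ∃ lM lP : E → ℝ, (∀ e, 0 ≤ lM e) ∧ (∀ e, 0 ≤ lP e) ∧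
      ∑ v, N.vertexCost lM lP v ≤ N.maxThroughputSym s t ∧
      ∀ i, (∀ p, N.IsWalk (s i) (t i) p → 1 ≤ (p.map fun e => lP e + lM e).sum) ∨
        (∀ p, N.IsWalk (t i) (s i) p → 1 ≤ (p.map fun e => lP e + lM e).sum) := by
  obtain ⟨yM, yP, z, hyM, hyP, hdual⟩ := N.exists_dual s t hst
  set lM : E → ℝ := fun e => ∑ v, ∑ S ∈ (N.inE v).powerset, if e ∈ S then yM v S else 0 with hlM
  set lP : E → ℝ := fun e => ∑ v, ∑ S ∈ (N.outE v).powerset, if e ∈ S then yP v S else 0 with hlP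
  have hlM0 : ∀ e, 0 ≤ lM e := fun e => Finset.sum_nonneg fun v _ => Finset.sum_nonneg fun S _ => by
    split_ifs
    · exact hyM v S
    · exact le_rfl
  have hlP0 : ∀ e, 0 ≤ lP e := fun e => Finset.sum_nonneg fun v _ => Finset.sum_nonneg fun S _ => by
    split_ifs
    · exact hyP v S
    · exact le_rfl
  have hcM : ∀ v, lovasz (N.inE v) (N.rhoM v) lM ≤
      ∑ S ∈ (N.inE v).powerset, yM v S * N.rhoM v S := by
    intro v
    refine le_of_eq_of_le (lovasz_congr fun e he => ?_)
      ((N.isPolymatroidOn_rhoM v).lovasz_le_sum (yM v) (hyM v) (N.inE v).powerset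
        fun S hS => Finset.mem_powerset.1 hS)
    refine Finset.sum_eq_single v (fun w _ hw => Finset.sum_eq_zero fun S hS => if_neg fun heS => ?_)
      (fun h => absurd (Finset.mem_univ v) h)
    have h1 := N.mem_inE.1 (Finset.mem_powerset.1 hS heS)
    exact hw (h1.symm.trans (N.mem_inE.1 he))
  have hcP : ∀ v, lovasz (N.outE v) (N.rhoP v) lP ≤
      ∑ S ∈ (N.outE v).powerset, yP v S * N.rhoP v S := by
    intro v
    refine le_of_eq_of_le (lovasz_congr fun e he => ?_)
      ((N.isPolymatroidOn_rhoP v).lovasz_le_sum (yP v) (hyP v) (N.outE v).powerset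
        fun S hS => Finset.mem_powerset.1 hS)
    refine Finset.sum_eq_single v (fun w _ hw => Finset.sum_eq_zero fun S hS => if_neg fun heS => ?_)
      (fun h => absurd (Finset.mem_univ v) h)
    have h1 := N.mem_outE.1 (Finset.mem_powerset.1 hS heS)
    exact hw (h1.symm.trans (N.mem_outE.1 he))
  have hcost : ∑ v, N.vertexCost lM lP v ≤ N.maxThroughputSym s t := by
    have h := hdual (fun _ _ => 0) 1 (fun _ _ => le_rfl) zero_le_one
    simp only [ite_self, Finset.sum_const_zero, sub_zero, mul_one, mul_zero, add_zero] at h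
    refine le_trans ?_ h
    rw [← Finset.sum_add_distrib]
    exact Finset.sum_le_sum fun v _ => add_le_add (hcM v) (hcP v)
  have hswapM : ∀ p : List E, ∑ v, ∑ S ∈ (N.inE v).powerset,
      yM v S * ∑ e ∈ S, (if e ∈ p then (1 : ℝ) else 0) = ∑ e ∈ p.toFinset, lM e := by
    intro p
    have h1 : ∑ e ∈ p.toFinset, lM e = ∑ e, if e ∈ p then lM e else 0 := by
      rw [← Finset.sum_filter]
      refine Finset.sum_congr ?_ fun _ _ => rfl
      ext e
      simp
    rw [h1, hlM]
    have h2 : ∀ e : E, (if e ∈ p then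
        ∑ v, ∑ S ∈ (N.inE v).powerset, (if e ∈ S then yM v S else 0) else 0) =
        ∑ v, ∑ S ∈ (N.inE v).powerset, if e ∈ S then yM v S * (if e ∈ p then 1 else 0) else 0 := by
      intro e
      split_ifs with h <;> simp
    simp only [h2]
    rw [Finset.sum_comm]
    refine Finset.sum_congr rfl fun v _ => ?_
    rw [Finset.sum_comm]
    refine Finset.sum_congr rfl fun S _ => ?_
    rw [Finset.mul_sum, ← Finset.sum_filter, Finset.filter_mem_eq_inter, Finset.univ_inter]
  have hswapP : ∀ p : List E, ∑ v, ∑ S ∈ (N.outE v).powerset,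
      yP v S * ∑ e ∈ S, (if e ∈ p then (1 : ℝ) else 0) = ∑ e ∈ p.toFinset, lP e := by
    intro p
    have h1 : ∑ e ∈ p.toFinset, lP e = ∑ e, if e ∈ p then lP e else 0 := by
      rw [← Finset.sum_filter]
      refine Finset.sum_congr ?_ fun _ _ => rfl
      ext e
      simp
    rw [h1, hlP]
    have h2 : ∀ e : E, (if e ∈ p then
        ∑ v, ∑ S ∈ (N.outE v).powerset, (if e ∈ S then yP v S else 0) else 0) =
        ∑ v, ∑ S ∈ (N.outE v).powerset, if e ∈ S then yP v S * (if e ∈ p then 1 else 0) else 0 := by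
      intro e
      split_ifs with h <;> simp
    simp only [h2]
    rw [Finset.sum_comm]
    refine Finset.sum_congr rfl fun v _ => ?_
    rw [Finset.sum_comm]
    refine Finset.sum_congr rfl fun S _ => ?_
    rw [Finset.mul_sum, ← Finset.sum_filter, Finset.filter_mem_eq_inter, Finset.univ_inter]
  have hpath : ∀ j, ∀ p ∈ N.symPaths s t j,
      1 + (∑ i, z i * ((if Sum.inl i = j then 1 else 0) - (if Sum.inr i = j then 1 else 0))) ≤
        ∑ e ∈ p.toFinset, (lP e + lM e) := by
    intro j p hp
    have h := hdual (fun j' p' => if j' = j then (if p' = p then 1 else 0) else 0) 0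
      (fun j' p' => by split_ifs <;> norm_num) le_rfl
    have hfl : ∀ e, ∑ j', ∑ p' ∈ N.symPaths s t j',
        (if e ∈ p' then (if j' = j then (if p' = p then (1 : ℝ) else 0) else 0) else 0) =
        if e ∈ p then 1 else 0 := by
      intro e
      rw [Finset.sum_eq_single j (fun j' _ hj' => by simp [hj']) (by simp),
        Finset.sum_eq_single p (fun p' _ hp' => by simp [hp']) (fun hp' => absurd hp hp')]
      simp
    have hrt : ∀ j', ∑ p' ∈ N.symPaths s t j',
        (if j' = j then (if p' = p then (1 : ℝ) else 0) else 0) = if j' = j then 1 else 0 := by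
      intro j'
      by_cases hj : j' = j
      · subst hj
        simp [hp]
      · simp [hj]
    simp only [hfl, hrt, mul_zero, zero_sub, mul_neg, Finset.sum_neg_distrib, hswapM, hswapP,
      Finset.sum_ite_eq', Finset.mem_univ, if_true] at h
    rw [Finset.sum_add_distrib]
    linarith
  refine ⟨lM, lP, hlM0, hlP0, hcost, fun i => ?_⟩
  have hwalk : ∀ j, 1 ≤ 1 + (∑ i, z i * ((if Sum.inl i = j then 1 else 0) -
      (if Sum.inr i = j then 1 else 0))) →
      ∀ p, N.IsWalk (Sum.elim s t j) (Sum.elim t s j) p →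
        1 ≤ (p.map fun e => lP e + lM e).sum := by
    intro j hj p hp
    obtain ⟨q, hq, hsub⟩ := hp.exists_isPath
    have h0 : ∀ e, 0 ≤ lP e + lM e := fun e => add_nonneg (hlP0 e) (hlM0 e)
    calc (1 : ℝ) ≤ _ := hj
      _ ≤ ∑ e ∈ q.toFinset, (lP e + lM e) := hpath j q (N.mem_symPaths.2 hq)
      _ ≤ ∑ e ∈ p.toFinset, (lP e + lM e) := by
        refine Finset.sum_le_sum_of_subset_of_nonneg (fun e he => ?_) fun e _ _ => h0 e
        rw [List.mem_toFinset] at he ⊢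
        exact hsub he
      _ ≤ _ := sum_toFinset_le_sum_map h0 p
  rcases le_total 0 (z i) with hz | hz
  · refine Or.inl (hwalk (Sum.inl i) ?_)
    simpa using hz
  · refine Or.inr (hwalk (Sum.inr i) ?_)
    simpa using hz

/-- The distance from `a` to `v` with respect to edge lengths `l`, truncated at one. -/
noncomputable def truncDist (N : DirPolyNet V E) (l : E → ℝ) (a v : V) : ℝ :=
  sInf (insert 1 {c | ∃ p, N.IsWalk a v p ∧ c = (p.map l).sum})

lemma bddBelow_truncDist (N : DirPolyNet V E) {l : E → ℝ} (hl : ∀ e, 0 ≤ l e) (a v : V) :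
    BddBelow (insert 1 {c | ∃ p, N.IsWalk a v p ∧ c = (p.map l).sum}) := by
  refine ⟨0, ?_⟩
  rintro c (rfl | ⟨p, -, rfl⟩)
  · exact zero_le_one
  · refine List.sum_nonneg fun x hx => ?_
    obtain ⟨e, -, rfl⟩ := List.mem_map.1 hx
    exact hl e

lemma truncDist_self_le (N : DirPolyNet V E) {l : E → ℝ} (hl : ∀ e, 0 ≤ l e) (a : V) :
    N.truncDist l a a ≤ 0 :=
  csInf_le (N.bddBelow_truncDist hl a a) (Set.mem_insert_of_mem _ ⟨[], rfl, by simp⟩)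

lemma one_le_truncDist (N : DirPolyNet V E) {l : E → ℝ} {a b : V}
    (h : ∀ p, N.IsWalk a b p → 1 ≤ (p.map l).sum) : 1 ≤ N.truncDist l a b := by
  refine le_csInf ⟨1, Set.mem_insert _ _⟩ ?_
  rintro c (rfl | ⟨p, hp, rfl⟩)
  · exact le_rfl
  · exact h p hp

lemma truncDist_head_le (N : DirPolyNet V E) {l : E → ℝ} (hl : ∀ e, 0 ≤ l e) (a : V) (e : E) :
    N.truncDist l a (N.head e) ≤ N.truncDist l a (N.tail e) + l e := by
  rw [← sub_le_iff_le_add]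
  refine le_csInf ⟨1, Set.mem_insert _ _⟩ ?_
  rintro c (rfl | ⟨p, hp, rfl⟩)
  · have : N.truncDist l a (N.head e) ≤ 1 :=
      csInf_le (N.bddBelow_truncDist hl _ _) (Set.mem_insert _ _)
    linarith [hl e]
  · have : N.truncDist l a (N.head e) ≤ ((p ++ [e]).map l).sum :=
      csInf_le (N.bddBelow_truncDist hl _ _) (Set.mem_insert_of_mem _ ⟨_, hp.append_edge, rfl⟩)
    simp only [List.map_append, List.map_cons, List.map_nil, List.sum_append, List.sum_cons,
      List.sum_nil, add_zero] at this
    linarith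

end DirPolyNet

namespace DirPolyNet

variable {V E : Type} [Fintype V] [Fintype E] [DecidableEq V] [DecidableEq E]

/-- The cost of a cut in which the edges of `M` are charged to their heads and the edges of `P`
to their tails. -/
noncomputable def splitCost (N : DirPolyNet V E) (M P : Finset E) : ℝ :=
  ∑ v, (N.rhoM v (N.inE v ∩ M) + N.rhoP v (N.outE v ∩ P))

lemma splitCost_empty (N : DirPolyNet V E) : N.splitCost ∅ ∅ = 0 := by
  simp [splitCost, N.rhoM_empty, N.rhoP_empty]

lemma splitCost_union_le (N : DirPolyNet V E) (M P M' P' : Finset E) :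
    N.splitCost (M ∪ M') (P ∪ P') ≤ N.splitCost M P + N.splitCost M' P' := by
  unfold splitCost
  rw [← Finset.sum_add_distrib]
  refine Finset.sum_le_sum fun v _ => ?_
  rw [Finset.inter_union_distrib_left, Finset.inter_union_distrib_left]
  have h1 := (N.isPolymatroidOn_rhoM v).union_le (A := N.inE v ∩ M) (B := N.inE v ∩ M')
    Finset.inter_subset_left Finset.inter_subset_left
  have h2 := (N.isPolymatroidOn_rhoP v).union_le (A := N.outE v ∩ P) (B := N.outE v ∩ P')
    Finset.inter_subset_left Finset.inter_subset_left
  linarith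

lemma cutCost_le_splitCost (N : DirPolyNet V E) {M P : Finset E}
    (hloop : ∀ e ∈ M ∪ P, N.tail e ≠ N.head e) : N.cutCost (M ∪ P) ≤ N.splitCost M P := by
  have hbdd : BddBelow { c : ℝ | ∃ g : E → V, N.Valid (M ∪ P) g ∧
    c = ∑ v : V, (N.rhoM v ((N.inE v ∩ (M ∪ P)).filter (fun e => g e = v)) +
                  N.rhoP v ((N.outE v ∩ (M ∪ P)).filter (fun e => g e = v))) } := by
    refine ⟨0, ?_⟩
    rintro c ⟨g, -, rfl⟩
    exact Finset.sum_nonneg fun v _ => add_nonneg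
      ((N.isPolymatroidOn_rhoM v).nonneg ((Finset.filter_subset _ _).trans Finset.inter_subset_left))
      ((N.isPolymatroidOn_rhoP v).nonneg ((Finset.filter_subset _ _).trans Finset.inter_subset_left))
  refine (csInf_le hbdd ⟨fun e => if e ∈ P then N.tail e else N.head e, fun e _ => ?_, rfl⟩).trans ?_
  · by_cases he : e ∈ P <;> simp [he]
  · refine Finset.sum_le_sum fun v _ => add_le_add ?_ ?_
    · refine (N.isPolymatroidOn_rhoM v).mono _ _ (fun e he => ?_) Finset.inter_subset_left
      obtain ⟨h1, h2⟩ := Finset.mem_filter.1 he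
      obtain ⟨h3, h4⟩ := Finset.mem_inter.1 h1
      refine Finset.mem_inter.2 ⟨h3, ?_⟩
      by_cases heP : e ∈ P
      · simp only [if_pos heP] at h2
        exact absurd (h2.trans (N.mem_inE.1 h3).symm) (hloop e h4)
      · exact (Finset.mem_union.1 h4).resolve_right heP
    · refine (N.isPolymatroidOn_rhoP v).mono _ _ (fun e he => ?_) Finset.inter_subset_left
      obtain ⟨h1, h2⟩ := Finset.mem_filter.1 he
      obtain ⟨h3, h4⟩ := Finset.mem_inter.1 h1
      refine Finset.mem_inter.2 ⟨h3, ?_⟩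
      by_contra heP
      simp only [if_neg heP] at h2
      exact hloop e h4 ((N.mem_outE.1 h3).trans h2.symm)

/-- All long edges can be cut at cost inversely proportional to the length threshold. -/
lemma splitCost_long_le (N : DirPolyNet V E) (lM lP : E → ℝ) {ε : ℝ} (hε : 0 < ε) :
    N.splitCost (Finset.univ.filter fun e => ε ≤ lM e ∧ N.tail e ≠ N.head e)
      (Finset.univ.filter fun e => ε ≤ lP e ∧ N.tail e ≠ N.head e) ≤
      ε⁻¹ * ∑ v, N.vertexCost lM lP v := by
  rw [splitCost, Finset.mul_sum]
  refine Finset.sum_le_sum fun v _ => ?_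
  rw [vertexCost, mul_add]
  refine add_le_add ?_ ?_
  · rw [← div_eq_inv_mul, le_div_iff₀' hε]
    refine le_trans ?_ ((N.isPolymatroidOn_rhoM v).level_mul_le lM hε)
    refine mul_le_mul_of_nonneg_left ((N.isPolymatroidOn_rhoM v).mono _ _ (fun e he => ?_)
      (Finset.filter_subset _ _)) hε.le
    obtain ⟨h1, h2⟩ := Finset.mem_inter.1 he
    exact Finset.mem_filter.2 ⟨h1, (Finset.mem_filter.1 h2).2.1⟩
  · rw [← div_eq_inv_mul, le_div_iff₀' hε]
    refine le_trans ?_ ((N.isPolymatroidOn_rhoP v).level_mul_le lP hε)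
    refine mul_le_mul_of_nonneg_left ((N.isPolymatroidOn_rhoP v).mono _ _ (fun e he => ?_)
      (Finset.filter_subset _ _)) hε.le
    obtain ⟨h1, h2⟩ := Finset.mem_inter.1 he
    exact Finset.mem_filter.2 ⟨h1, (Finset.mem_filter.1 h2).2.1⟩

/-- Cutting the short edges across a threshold of a potential, with the threshold chosen in a
window of width `ε`, costs at most `ε⁻¹` times the vertex costs near the window. -/
lemma exists_threshold (N : DirPolyNet V E) {lM lP : E → ℝ} {φ : V → ℝ}
    (hφ : ∀ e, φ (N.head e) ≤ φ (N.tail e) + (lP e + lM e)) (A : Finset V) {ε : ℝ} (hε : 0 < ε)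
    (a : ℝ) :
    ∃ r ∈ Set.Icc a (a + ε), ∃ M P : Finset E, (∀ e ∈ M ∪ P, N.tail e ≠ N.head e) ∧
      N.splitCost M P ≤
        ε⁻¹ * ∑ v ∈ A.filter (fun v => a - ε < φ v ∧ φ v < a + 2 * ε), N.vertexCost lM lP v ∧
      ∀ e, N.tail e ∈ A → N.head e ∈ A → lM e < ε → lP e < ε →
        φ (N.tail e) ≤ r → r < φ (N.head e) → e ∈ M ∪ P := by
  set B := A.filter (fun v => a - ε < φ v ∧ φ v < a + 2 * ε) with hB
  set c : ℝ → ℝ := fun r => ∑ v ∈ B, (levelValue (N.inE v) (N.rhoM v) lM (φ v - r) +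
    levelValue (N.outE v) (N.rhoP v) lP (r - φ v)) with hc
  have hvol : volume (Set.Icc a (a + ε)) = ENNReal.ofReal ε := by
    rw [Real.volume_Icc]
    congr 1
    ring
  have hM := fun v => (N.isPolymatroidOn_rhoM v).setIntegral_levelValue_sub_le' lM (φ v)
    (Set.Icc a (a + ε))
  have hP := fun v => (N.isPolymatroidOn_rhoP v).setIntegral_levelValue_sub_le lP (φ v)
    (Set.Icc a (a + ε))
  have hadd : ∀ v, IntegrableOn (fun r => levelValue (N.inE v) (N.rhoM v) lM (φ v - r) +
      levelValue (N.outE v) (N.rhoP v) lP (r - φ v)) (Set.Icc a (a + ε)) :=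
    fun v => (hM v).1.add (hP v).1
  have hint : IntegrableOn c (Set.Icc a (a + ε)) := integrable_finsetSum _ fun v _ => hadd v
  obtain ⟨r, hr, hrc⟩ := exists_le_setAverage (μ := volume) (s := Set.Icc a (a + ε)) (f := c)
    (by rw [hvol]; simpa using hε) (by rw [hvol]; exact ENNReal.ofReal_ne_top) hint
  have hcr : c r ≤ ε⁻¹ * ∑ v ∈ B, N.vertexCost lM lP v := by
    refine hrc.trans ?_
    rw [setAverage_eq, measureReal_def, hvol, ENNReal.toReal_ofReal hε.le, smul_eq_mul]
    refine mul_le_mul_of_nonneg_left ?_ (inv_nonneg.2 hε.le)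
    simp only [hc]
    rw [integral_finsetSum _ fun v _ => hadd v]
    refine Finset.sum_le_sum fun v _ => ?_
    rw [integral_add (hM v).1 (hP v).1]
    exact add_le_add (hM v).2 (hP v).2
  set C : Finset E := Finset.univ.filter fun e => N.tail e ∈ A ∧ N.head e ∈ A ∧ lM e < ε ∧
    lP e < ε ∧ φ (N.tail e) ≤ r ∧ r < φ (N.head e) with hC
  refine ⟨r, hr, C.filter (fun e => φ (N.tail e) + lP e ≤ r),
    C.filter (fun e => r < φ (N.tail e) + lP e), ?_, le_trans ?_ hcr, ?_⟩
  · intro e he heq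
    have he' : e ∈ C := by
      rcases Finset.mem_union.1 he with h | h <;> exact (Finset.mem_filter.1 h).1
    obtain ⟨-, -, -, -, -, h1, h2⟩ := Finset.mem_filter.1 he'
    rw [heq] at h1
    linarith
  · rw [splitCost, hc]
    rw [← Finset.sum_subset (Finset.subset_univ B)]
    · refine Finset.sum_le_sum fun v _ => add_le_add ?_ ?_
      · by_cases hv : 0 ≤ φ v - r
        · rw [levelValue, if_pos hv]
          refine (N.isPolymatroidOn_rhoM v).mono _ _ (fun e he => ?_) (Finset.filter_subset _ _)
          obtain ⟨h1, h2⟩ := Finset.mem_inter.1 he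
          obtain ⟨-, h4⟩ := Finset.mem_filter.1 h2
          refine Finset.mem_filter.2 ⟨h1, ?_⟩
          have h5 := hφ e
          rw [N.mem_inE.1 h1] at h5
          linarith
        · have h0 : N.inE v ∩ C.filter (fun e => φ (N.tail e) + lP e ≤ r) = ∅ := by
            refine Finset.eq_empty_of_forall_notMem fun e he => hv ?_
            obtain ⟨h1, h2⟩ := Finset.mem_inter.1 he
            obtain ⟨-, -, -, -, -, -, h6⟩ := Finset.mem_filter.1 (Finset.mem_filter.1 h2).1
            rw [N.mem_inE.1 h1] at h6
            linarith
          rw [h0, N.rhoM_empty]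
          exact (N.isPolymatroidOn_rhoM v).levelValue_nonneg _ _
      · by_cases hv : 0 ≤ r - φ v
        · rw [levelValue, if_pos hv]
          refine (N.isPolymatroidOn_rhoP v).mono _ _ (fun e he => ?_) (Finset.filter_subset _ _)
          obtain ⟨h1, h2⟩ := Finset.mem_inter.1 he
          obtain ⟨-, h4⟩ := Finset.mem_filter.1 h2
          refine Finset.mem_filter.2 ⟨h1, ?_⟩
          rw [N.mem_outE.1 h1] at h4
          linarith
        · have h0 : N.outE v ∩ C.filter (fun e => r < φ (N.tail e) + lP e) = ∅ := by
            refine Finset.eq_empty_of_forall_notMem fun e he => hv ?_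
            obtain ⟨h1, h2⟩ := Finset.mem_inter.1 he
            obtain ⟨-, -, -, -, -, h6, -⟩ := Finset.mem_filter.1 (Finset.mem_filter.1 h2).1
            rw [N.mem_outE.1 h1] at h6
            linarith
          rw [h0, N.rhoP_empty]
          exact (N.isPolymatroidOn_rhoP v).levelValue_nonneg _ _
    · intro v _ hv
      have h0 : N.inE v ∩ C.filter (fun e => φ (N.tail e) + lP e ≤ r) = ∅ := by
        refine Finset.eq_empty_of_forall_notMem fun e he => hv ?_
        obtain ⟨h1, h2⟩ := Finset.mem_inter.1 he
        obtain ⟨h3, h4⟩ := Finset.mem_filter.1 h2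
        obtain ⟨-, -, hA, h5, -, -, h6⟩ := Finset.mem_filter.1 h3
        have h7 := hφ e
        rw [N.mem_inE.1 h1] at hA h6 h7
        exact Finset.mem_filter.2 ⟨hA, by linarith [hr.1], by linarith [hr.2]⟩
      have h0' : N.outE v ∩ C.filter (fun e => r < φ (N.tail e) + lP e) = ∅ := by
        refine Finset.eq_empty_of_forall_notMem fun e he => hv ?_
        obtain ⟨h1, h2⟩ := Finset.mem_inter.1 he
        obtain ⟨h3, h4⟩ := Finset.mem_filter.1 h2
        obtain ⟨-, hA, -, -, h5, h6, -⟩ := Finset.mem_filter.1 h3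
        rw [N.mem_outE.1 h1] at hA h6 h4
        exact Finset.mem_filter.2 ⟨hA, by linarith [hr.1], by linarith [hr.2]⟩
      rw [h0, h0', N.rhoM_empty, N.rhoP_empty, add_zero]
  · intro e h1 h2 h3 h4 h5 h6
    have heC : e ∈ C := Finset.mem_filter.2 ⟨Finset.mem_univ _, h1, h2, h3, h4, h5, h6⟩
    rcases le_or_gt (φ (N.tail e) + lP e) r with h | h
    · exact Finset.mem_union_left _ (Finset.mem_filter.2 ⟨heC, h⟩)
    · exact Finset.mem_union_right _ (Finset.mem_filter.2 ⟨heC, h⟩)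

end DirPolyNet

/-- A chain of positive reals that stays below `W / 2` for long enough has a step of small
relative growth. -/
lemma exists_small_growth {b : ℕ → ℝ} {W Λ : ℝ} {J : ℕ} (hb : Monotone b) (hb0 : 0 < b 0)
    (hbJ : b J ≤ W / 2) (hlog : Real.log (W / b 0) ≤ Λ) (hΛ : 0 < Λ)
    (hJ : 2 * Λ * Real.log (Λ / Real.log 2) < J) :
    ∃ j < J, ∀ x ∈ Set.Icc (b j) (b (j + 1)),
      b (j + 1) - b j ≤ 2 / Λ * (x * Real.log (W / x)) := by
  have hpos : ∀ j, 0 < b j := fun j => hb0.trans_le (hb (Nat.zero_le j))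
  have hW : 0 < W := by linarith [hpos J]
  have hlog2 : 0 < Real.log 2 := Real.log_pos (by norm_num)
  have hu2 : ∀ x, 0 < x → x ≤ W / 2 → Real.log 2 ≤ Real.log (W / x) := fun x hx hxW => by
    refine Real.log_le_log (by norm_num) ?_
    rw [le_div_iff₀ hx]
    linarith
  have huΛ : ∀ j, Real.log (W / b j) ≤ Λ := fun j => by
    refine le_trans (Real.log_le_log (div_pos hW (hpos j)) ?_) hlog
    exact div_le_div_of_nonneg_left hW.le hb0 (hb (Nat.zero_le j))
  have hstep : ∃ j < J, b (j + 1) ≤ b j * (1 + Real.log (W / b j) / Λ) := by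
    by_contra! hcon
    have hind : ∀ j ≤ J, Real.log (W / b j) ≤ Λ * Real.exp (-(j / (2 * Λ))) := by
      intro j
      induction j with
      | zero => intro _; simpa using hlog
      | succ j ih =>
        intro hj
        have h1 := ih (by omega)
        have h2 := hcon j (by omega)
        have h3 : Real.log 2 ≤ Real.log (W / b j) :=
          hu2 _ (hpos j) ((hb (by omega : j ≤ J)).trans hbJ)
        set u := Real.log (W / b j) with hu
        have hx0 : 0 ≤ u / Λ := div_nonneg (by linarith) hΛ.le
        have hx1 : u / Λ ≤ 1 := (div_le_one hΛ).2 (huΛ j)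
        have h4 : u / Λ / 2 ≤ Real.log (1 + u / Λ) := by
          refine le_trans ?_ (Real.one_sub_inv_le_log_of_pos (by linarith))
          have h1x : 1 + u / Λ ≠ 0 := by linarith
          have : 1 - (1 + u / Λ)⁻¹ = u / Λ / (1 + u / Λ) := by
            rw [eq_div_iff h1x, sub_mul, inv_mul_cancel₀ h1x]
            ring
          rw [this]
          exact div_le_div_of_nonneg_left hx0 (by linarith) (by linarith)
        have h5 : Real.log (W / b (j + 1)) ≤ u - Real.log (1 + u / Λ) := by
          have h6 := Real.log_le_log (mul_pos (hpos j) (by linarith)) h2.le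
          rw [Real.log_mul (hpos j).ne' (by linarith)] at h6
          rw [Real.log_div hW.ne' (hpos _).ne'] at hu ⊢
          linarith
        have h6 : 1 - 1 / (2 * Λ) ≤ Real.exp (-(1 / (2 * Λ))) := by
          have := Real.add_one_le_exp (-(1 / (2 * Λ)))
          linarith
        calc Real.log (W / b (j + 1)) ≤ u * (1 - 1 / (2 * Λ)) := by
              have : u * (1 - 1 / (2 * Λ)) = u - u / Λ / 2 := by
                field_simp
              linarith
          _ ≤ u * Real.exp (-(1 / (2 * Λ))) := mul_le_mul_of_nonneg_left h6 (by linarith)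
          _ ≤ Λ * Real.exp (-(j / (2 * Λ))) * Real.exp (-(1 / (2 * Λ))) :=
              mul_le_mul_of_nonneg_right h1 (Real.exp_pos _).le
          _ = Λ * Real.exp (-((j + 1 : ℕ) / (2 * Λ))) := by
              rw [mul_assoc, ← Real.exp_add]
              congr 2
              push_cast
              ring
    have h1 := (hu2 _ (hpos J) hbJ).trans (hind J le_rfl)
    have h2 : Real.exp (-(J / (2 * Λ))) < Real.log 2 / Λ := by
      rw [← Real.lt_log_iff_exp_lt (div_pos hlog2 hΛ), ← inv_div Λ, Real.log_inv, neg_lt_neg_iff,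
        lt_div_iff₀ (by positivity)]
      linarith
    rw [lt_div_iff₀ hΛ] at h2
    linarith
  obtain ⟨j, hj, hle⟩ := hstep
  refine ⟨j, hj, fun x hx => ?_⟩
  have hxpos : 0 < x := (hpos j).trans_le hx.1
  have hxW : x ≤ W / 2 := hx.2.trans ((hb (by omega : j + 1 ≤ J)).trans hbJ)
  have hx2 : x ≤ 2 * b j := by
    have h1 : Real.log (W / b j) / Λ ≤ 1 := (div_le_one hΛ).2 (huΛ j)
    have h2 := mul_le_mul_of_nonneg_left h1 (hpos j).le
    linarith [hx.2]
  have hWx : 2 ≤ W / x := by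
    rw [le_div_iff₀ hxpos]
    linarith
  have h1 : Real.log (W / b j) ≤ 2 * Real.log (W / x) := by
    have h2 : W / b j ≤ 2 * (W / x) := by
      rw [← mul_div_assoc, div_le_div_iff₀ (hpos j) hxpos]
      nlinarith
    have h3 := Real.log_le_log (div_pos hW (hpos j)) h2
    rw [Real.log_mul (by norm_num) (by positivity)] at h3
    linarith [hu2 x hxpos hxW]
  have h0 : 0 ≤ Real.log (W / b j) := hlog2.le.trans (hu2 _ (hpos j) (hx.1.trans hxW))
  calc b (j + 1) - b j ≤ b j * Real.log (W / b j) / Λ := by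
        rw [mul_add, mul_one, ← mul_div_assoc] at hle
        linarith
    _ ≤ x * (2 * Real.log (W / x)) / Λ := by
        refine div_le_div_of_nonneg_right ?_ hΛ.le
        exact mul_le_mul hx.1 h1 h0 hxpos.le
    _ = 2 / Λ * (x * Real.log (W / x)) := by ring

namespace DirPolyNet

variable {V E : Type} [Fintype V] [Fintype E] [DecidableEq V] [DecidableEq E]

/-- Some threshold along a chain of vertex sets gives a cut that can be charged to the weight of
any set squeezed between two consecutive members of the chain. -/
lemma exists_chain_threshold (N : DirPolyNet V E) {lM lP : E → ℝ} {φ : V → ℝ}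
    (hφ : ∀ e, φ (N.head e) ≤ φ (N.tail e) + (lP e + lM e)) {A : Finset V} {w : V → ℝ}
    (hw : ∀ v, 0 ≤ w v) (hcost : ∀ v, N.vertexCost lM lP v ≤ w v) {ε w₀ Λ : ℝ} (hε : 0 < ε)
    (hw₀ : 0 < w₀) (hΛ : 0 < Λ) (hlog : Real.log ((∑ v ∈ A, w v) / w₀) ≤ Λ) {J : ℕ}
    (hJ : 2 * Λ * Real.log (Λ / Real.log 2) < J) {U : ℕ → Finset V} (hU : Monotone U)
    (hU₀ : w₀ ≤ ∑ v ∈ U 0, w v) (hUJ : ∑ v ∈ U J, w v ≤ (∑ v ∈ A, w v) / 2) (a : ℕ → ℝ)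
    (hwin : ∀ j, ∀ v ∈ A, a j - ε < φ v → φ v < a j + 2 * ε → v ∈ U (j + 1) \ U j) :
    ∃ j < J, ∃ r ∈ Set.Icc (a j) (a j + ε), ∃ M P : Finset E,
      (∀ e ∈ M ∪ P, N.tail e ≠ N.head e) ∧
      (∀ X : Finset V, U j ⊆ X → X ⊆ U (j + 1) → N.splitCost M P ≤
        ε⁻¹ * (2 / Λ) * ((∑ v ∈ X, w v) * Real.log ((∑ v ∈ A, w v) / ∑ v ∈ X, w v))) ∧
      ∀ e, N.tail e ∈ A → N.head e ∈ A → lM e < ε → lP e < ε →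
        φ (N.tail e) ≤ r → r < φ (N.head e) → e ∈ M ∪ P := by
  have hmono : ∀ {X Y : Finset V}, X ⊆ Y → ∑ v ∈ X, w v ≤ ∑ v ∈ Y, w v := fun h =>
    Finset.sum_le_sum_of_subset_of_nonneg h fun v _ _ => hw v
  have hb : Monotone fun j => ∑ v ∈ U j, w v := fun i j hij => hmono (hU hij)
  have hW : 0 < ∑ v ∈ A, w v := by
    have := hb (Nat.zero_le J)
    simp only at this
    linarith
  obtain ⟨j, hj, hx⟩ := exists_small_growth hb (hw₀.trans_le hU₀) hUJ
    ((Real.log_le_log (div_pos hW (hw₀.trans_le hU₀))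
      (div_le_div_of_nonneg_left hW.le hw₀ hU₀)).trans hlog) hΛ hJ
  obtain ⟨r, hr, M, P, hloop, hMP, hcut⟩ := N.exists_threshold hφ A hε (a j)
  refine ⟨j, hj, r, hr, M, P, hloop, fun X hX1 hX2 => hMP.trans ?_, hcut⟩
  rw [mul_assoc]
  refine mul_le_mul_of_nonneg_left (le_trans ?_ (hx _ ⟨hmono hX1, hmono hX2⟩)) (inv_nonneg.2 hε.le)
  rw [← Finset.sum_sdiff (hU (Nat.le_succ j)), add_sub_cancel_right]
  refine (Finset.sum_le_sum fun v _ => hcost v).trans (hmono fun v hv => ?_)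
  obtain ⟨h1, h2, h3⟩ := Finset.mem_filter.1 hv
  exact hwin j v h1 h2 h3

/-- Region growing, from whichever of the two ends is lighter. -/
lemma exists_region_cut (N : DirPolyNet V E) {lM lP : E → ℝ} {φ : V → ℝ}
    (hφ : ∀ e, φ (N.head e) ≤ φ (N.tail e) + (lP e + lM e)) {A : Finset V} {w : V → ℝ}
    (hw : ∀ v, 0 ≤ w v) (hcost : ∀ v, N.vertexCost lM lP v ≤ w v) {w₀ Λ : ℝ}
    (hw₀ : 0 < w₀) (hΛ : 0 < Λ) (hlog : Real.log ((∑ v ∈ A, w v) / w₀) ≤ Λ) {J : ℕ} (hJ₀ : 0 < J)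
    (hJ : 2 * Λ * Real.log (Λ / Real.log 2) < J) {a b : V} (ha : a ∈ A) (hb : b ∈ A)
    (hwa : w₀ ≤ w a) (hwb : w₀ ≤ w b) (hφa : φ a ≤ 0) (hφb : 1 ≤ φ b) :
    ∃ B ⊆ A, a ∈ B ∧ b ∉ B ∧ ∃ M P : Finset E, (∀ e ∈ M ∪ P, N.tail e ≠ N.head e) ∧
      N.splitCost M P ≤ 16 * J / Λ *
        ((∑ v ∈ B, w v) * Real.log ((∑ v ∈ A, w v) / ∑ v ∈ B, w v) +
          (∑ v ∈ A \ B, w v) * Real.log ((∑ v ∈ A, w v) / ∑ v ∈ A \ B, w v)) ∧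
      ∀ e, N.tail e ∈ B → N.head e ∈ A \ B → lM e < 1 / (8 * J) → lP e < 1 / (8 * J) →
        e ∈ M ∪ P := by
  have hJ' : (0 : ℝ) < J := by exact_mod_cast hJ₀
  set ε : ℝ := 1 / (8 * J) with hε
  have hε₀ : 0 < ε := by positivity
  have hεJ : ε * J = 1 / 8 := by
    rw [hε]
    field_simp
  have hεj : ∀ j : ℕ, j < J → ε * j + ε ≤ 1 / 8 := fun j hj => by
    have : ((j + 1 : ℕ) : ℝ) ≤ J := by exact_mod_cast hj
    push_cast at this
    nlinarith
  have hεi : ε⁻¹ * (2 / Λ) = 16 * J / Λ := by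
    rw [hε]
    field_simp
    norm_num
  have hmono : ∀ {X Y : Finset V}, X ⊆ Y → ∑ v ∈ X, w v ≤ ∑ v ∈ Y, w v := fun h =>
    Finset.sum_le_sum_of_subset_of_nonneg h fun v _ _ => hw v
  have hge : ∀ {X : Finset V} {v : V}, v ∈ X → w v ≤ ∑ v ∈ X, w v := fun h =>
    Finset.single_le_sum (fun v _ => hw v) h
  have hent : ∀ X ⊆ A, 0 ≤ (∑ v ∈ X, w v) * Real.log ((∑ v ∈ A, w v) / ∑ v ∈ X, w v) :=
    fun X hX => by
      rcases (Finset.sum_nonneg fun v _ => hw v : 0 ≤ ∑ v ∈ X, w v).eq_or_lt with h | h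
      · rw [← h, zero_mul]
      · exact mul_nonneg h.le (Real.log_nonneg ((one_le_div h).2 (hmono hX)))
  have hpos : 0 ≤ 16 * J / Λ := by positivity
  have hhalf : ∑ v ∈ A.filter (fun v => φ v ≤ 3 / 8), w v ≤ (∑ v ∈ A, w v) / 2 ∨
      ∑ v ∈ A.filter (fun v => 5 / 8 ≤ φ v), w v ≤ (∑ v ∈ A, w v) / 2 := by
    have hd : Disjoint (A.filter fun v => φ v ≤ 3 / 8) (A.filter fun v => 5 / 8 ≤ φ v) := by
      rw [Finset.disjoint_filter]
      intro v _ h1 h2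
      linarith
    have hsum := hmono (Finset.union_subset (Finset.filter_subset (fun v => φ v ≤ 3 / 8) A)
      (Finset.filter_subset (fun v => 5 / 8 ≤ φ v) A))
    rw [Finset.sum_union hd] at hsum
    by_contra! hcon
    linarith [hcon.1, hcon.2]
  rcases hhalf with hh | hh
  · obtain ⟨j, hj, r, hr, M, P, hloop, hMP, hcut⟩ := N.exists_chain_threshold hφ hw hcost hε₀ hw₀
      hΛ hlog hJ (U := fun j : ℕ => A.filter fun v => φ v ≤ 3 * (ε * j))
      (fun i j hij v hv => by
        obtain ⟨h1, h2⟩ := Finset.mem_filter.1 hv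
        have : ε * (i : ℝ) ≤ ε * j := mul_le_mul_of_nonneg_left (by exact_mod_cast hij) hε₀.le
        exact Finset.mem_filter.2 ⟨h1, by linarith⟩)
      (hwa.trans (hge (Finset.mem_filter.2 ⟨ha, by simpa using hφa⟩)))
      (by
        refine le_trans (hmono fun v hv => ?_) hh
        obtain ⟨h1, h2⟩ := Finset.mem_filter.1 hv
        exact Finset.mem_filter.2 ⟨h1, by linarith⟩)
      (fun j => 3 * (ε * j) + ε)
      (fun j v hv h1 h2 => by
        refine Finset.mem_sdiff.2 ⟨Finset.mem_filter.2 ⟨hv, ?_⟩, fun h => ?_⟩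
        · push_cast
          linarith
        · linarith [(Finset.mem_filter.1 h).2])
    have hj0 : 0 ≤ ε * j := by positivity
    have hr1 := hr.1
    have hr2 := hr.2
    refine ⟨A.filter fun v => φ v ≤ r, Finset.filter_subset _ _,
      Finset.mem_filter.2 ⟨ha, by linarith⟩, fun h => ?_, M, P, hloop, ?_, ?_⟩
    · linarith [(Finset.mem_filter.1 h).2, hεj j hj]
    · refine (hMP (A.filter fun v => φ v ≤ r) (fun v hv => ?_) (fun v hv => ?_)).trans ?_
      · obtain ⟨h1, h2⟩ := Finset.mem_filter.1 hv
        exact Finset.mem_filter.2 ⟨h1, by linarith⟩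
      · obtain ⟨h1, h2⟩ := Finset.mem_filter.1 hv
        refine Finset.mem_filter.2 ⟨h1, ?_⟩
        push_cast
        linarith
      · rw [hεi]
        exact mul_le_mul_of_nonneg_left (le_add_of_nonneg_right (hent _ Finset.sdiff_subset)) hpos
    · intro e h1 h2 h3 h4
      obtain ⟨h5, h6⟩ := Finset.mem_filter.1 h1
      obtain ⟨h7, h8⟩ := Finset.mem_sdiff.1 h2
      exact hcut e h5 h7 h3 h4 h6 (not_le.1 fun h => h8 (Finset.mem_filter.2 ⟨h7, h⟩))
  · obtain ⟨j, hj, r, hr, M, P, hloop, hMP, hcut⟩ := N.exists_chain_threshold hφ hw hcost hε₀ hw₀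
      hΛ hlog hJ (U := fun j : ℕ => A.filter fun v => 1 - 3 * (ε * j) ≤ φ v)
      (fun i j hij v hv => by
        obtain ⟨h1, h2⟩ := Finset.mem_filter.1 hv
        have : ε * (i : ℝ) ≤ ε * j := mul_le_mul_of_nonneg_left (by exact_mod_cast hij) hε₀.le
        exact Finset.mem_filter.2 ⟨h1, by linarith⟩)
      (hwb.trans (hge (Finset.mem_filter.2 ⟨hb, by simpa using hφb⟩)))
      (by
        refine le_trans (hmono fun v hv => ?_) hh
        obtain ⟨h1, h2⟩ := Finset.mem_filter.1 hv
        exact Finset.mem_filter.2 ⟨h1, by linarith⟩)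
      (fun j => 1 - 3 * (ε * j) - 2 * ε)
      (fun j v hv h1 h2 => by
        refine Finset.mem_sdiff.2 ⟨Finset.mem_filter.2 ⟨hv, ?_⟩, fun h => ?_⟩
        · push_cast
          linarith
        · linarith [(Finset.mem_filter.1 h).2])
    have hj0 : 0 ≤ ε * j := by positivity
    have hr1 := hr.1
    have hr2 := hr.2
    have hjJ := hεj j hj
    refine ⟨A.filter fun v => φ v ≤ r, Finset.filter_subset _ _,
      Finset.mem_filter.2 ⟨ha, by linarith⟩, fun h => ?_, M, P, hloop, ?_, ?_⟩
    · linarith [(Finset.mem_filter.1 h).2]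
    · refine (hMP (A \ A.filter fun v => φ v ≤ r) (fun v hv => ?_) (fun v hv => ?_)).trans ?_
      · obtain ⟨h1, h2⟩ := Finset.mem_filter.1 hv
        exact Finset.mem_sdiff.2 ⟨h1, fun h => by linarith [(Finset.mem_filter.1 h).2]⟩
      · obtain ⟨h1, h2⟩ := Finset.mem_sdiff.1 hv
        have h3 : r < φ v := not_le.1 fun h => h2 (Finset.mem_filter.2 ⟨h1, h⟩)
        refine Finset.mem_filter.2 ⟨h1, ?_⟩
        push_cast
        linarith
      · rw [hεi]
        exact mul_le_mul_of_nonneg_left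
          (le_add_of_nonneg_left (hent _ (Finset.filter_subset _ _))) hpos
    · intro e h1 h2 h3 h4
      obtain ⟨h5, h6⟩ := Finset.mem_filter.1 h1
      obtain ⟨h7, h8⟩ := Finset.mem_sdiff.1 h2
      exact hcut e h5 h7 h3 h4 h6 (not_le.1 fun h => h8 (Finset.mem_filter.2 ⟨h7, h⟩))

end DirPolyNet

namespace DirPolyNet

variable {V E : Type} [Fintype V] [Fintype E] [DecidableEq V] [DecidableEq E]

/-- One step along an edge of `D` with both ends in `A`. -/
def StepIn (N : DirPolyNet V E) (D : Set E) (A : Finset V) (u v : V) : Prop :=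
  ∃ e ∈ D, N.tail e = u ∧ N.head e = v ∧ u ∈ A ∧ v ∈ A

lemma reflTransGen_stepIn_of_isWalk (N : DirPolyNet V E) {D : Set E} {p : List E} :
    ∀ {u v : V}, N.IsWalk u v p → (∀ e ∈ p, e ∈ D ∨ N.tail e = N.head e) →
      Relation.ReflTransGen (N.StepIn D Finset.univ) u v := by
  induction p with
  | nil =>
    intro u v h _
    obtain rfl : u = v := h
    exact .refl
  | cons e p ih =>
    rintro u v ⟨rfl, h⟩ hp
    have h1 := ih h fun e he => hp e (List.mem_cons_of_mem _ he)
    rcases hp e List.mem_cons_self with h2 | h2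
    · exact .head ⟨e, h2, rfl, rfl, Finset.mem_univ _, Finset.mem_univ _⟩ h1
    · rwa [h2]

/-- A walk in `A` starting in a set without outgoing edges stays in that set. -/
lemma reflTransGen_stepIn_of_source (N : DirPolyNet V E) {D D' : Set E} {A B : Finset V}
    (hD : D ⊆ D') (hB : ∀ e ∈ D, N.tail e ∈ B → N.head e ∉ A \ B) {u v : V}
    (h : Relation.ReflTransGen (N.StepIn D A) u v) (hu : u ∈ B) :
    Relation.ReflTransGen (N.StepIn D' B) u v ∧ v ∈ B := by
  induction h with
  | refl => exact ⟨.refl, hu⟩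
  | tail _ hstep ih =>
    obtain ⟨e, he, rfl, rfl, -, h2⟩ := hstep
    have h3 : N.head e ∈ B := by
      by_contra h3
      exact hB e he ih.2 (Finset.mem_sdiff.2 ⟨h2, h3⟩)
    exact ⟨ih.1.tail ⟨e, hD he, rfl, rfl, ih.2, h3⟩, h3⟩

/-- A walk in `A` ending in a set without incoming edges stays in that set. -/
lemma reflTransGen_stepIn_of_target (N : DirPolyNet V E) {D D' : Set E} {A B : Finset V}
    (hD : D ⊆ D') (hB : ∀ e ∈ D, N.tail e ∈ B → N.head e ∉ A \ B) {u v : V}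
    (h : Relation.ReflTransGen (N.StepIn D A) u v) (hv : v ∈ A \ B) :
    Relation.ReflTransGen (N.StepIn D' (A \ B)) u v ∧ u ∈ A \ B := by
  induction h using Relation.ReflTransGen.head_induction_on with
  | refl => exact ⟨.refl, hv⟩
  | head hstep _ ih =>
    obtain ⟨e, he, rfl, rfl, h1, -⟩ := hstep
    have h3 : N.tail e ∈ A \ B := Finset.mem_sdiff.2 ⟨h1, fun h3 => hB e he h3 ih.2⟩
    exact ⟨.head ⟨e, hD he, rfl, rfl, h3, ih.2⟩ ih.1, h3⟩

/-- Recursive region growing: the short edges in `A` can be cut so that every demand pair in `A` is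
separated in one direction, with an entropy bound on the cost. -/
lemma exists_recursive_cut (N : DirPolyNet V E) {lM lP : E → ℝ} (hlM : ∀ e, 0 ≤ lM e)
    (hlP : ∀ e, 0 ≤ lP e) {w : V → ℝ} (hw : ∀ v, 0 ≤ w v)
    (hcost : ∀ v, N.vertexCost lM lP v ≤ w v) {w₀ Λ : ℝ} (hw₀ : 0 < w₀) (hΛ : 0 < Λ)
    {J : ℕ} (hJ₀ : 0 < J) (hJ : 2 * Λ * Real.log (Λ / Real.log 2) < J) {ι : Type} {s t : ι → V}
    (hs : ∀ i, w₀ ≤ w (s i)) (ht : ∀ i, w₀ ≤ w (t i))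
    (hlen : ∀ i, (∀ p, N.IsWalk (s i) (t i) p → 1 ≤ (p.map fun e => lP e + lM e).sum) ∨
      (∀ p, N.IsWalk (t i) (s i) p → 1 ≤ (p.map fun e => lP e + lM e).sum))
    (A : Finset V) (hA : w₀ ≤ ∑ v ∈ A, w v) (hlog : Real.log ((∑ v ∈ A, w v) / w₀) ≤ Λ) :
    ∃ M P : Finset E, (∀ e ∈ M ∪ P, N.tail e ≠ N.head e) ∧
      N.splitCost M P ≤
        16 * J / Λ * ((∑ v ∈ A, w v) * Real.log ((∑ v ∈ A, w v) / w₀)) ∧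
      ∀ i, s i ∈ A → t i ∈ A →
        ¬ Relation.ReflTransGen (N.StepIn {e | lM e < 1 / (8 * J) ∧ lP e < 1 / (8 * J) ∧
          e ∉ M ∪ P} A) (s i) (t i) ∨
        ¬ Relation.ReflTransGen (N.StepIn {e | lM e < 1 / (8 * J) ∧ lP e < 1 / (8 * J) ∧
          e ∉ M ∪ P} A) (t i) (s i) := by
  induction A using Finset.strongInduction with
  | H A ih =>
  by_cases hpair : ∃ i, s i ∈ A ∧ t i ∈ A
  swap
  · push Not at hpair
    refine ⟨∅, ∅, by simp, ?_, fun i h1 h2 => absurd h2 (hpair i h1)⟩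
    rw [N.splitCost_empty]
    have h1 := Real.log_nonneg ((one_le_div hw₀).2 hA)
    have h2 : 0 ≤ ∑ v ∈ A, w v := hw₀.le.trans hA
    positivity
  obtain ⟨i, hsi, hti⟩ := hpair
  obtain ⟨a, b, ha, hb, hwa, hwb, hab⟩ : ∃ a b, a ∈ A ∧ b ∈ A ∧ w₀ ≤ w a ∧ w₀ ≤ w b ∧
      ∀ p, N.IsWalk a b p → 1 ≤ (p.map fun e => lP e + lM e).sum := by
    rcases hlen i with h | h
    · exact ⟨_, _, hsi, hti, hs i, ht i, h⟩
    · exact ⟨_, _, hti, hsi, ht i, hs i, h⟩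
  have hl : ∀ e, 0 ≤ lP e + lM e := fun e => add_nonneg (hlP e) (hlM e)
  obtain ⟨B, hBA, haB, hbB, M, P, hloop, hMP, hcut⟩ := N.exists_region_cut
    (N.truncDist_head_le hl a) hw hcost hw₀ hΛ hlog hJ₀ hJ ha hb hwa hwb (N.truncDist_self_le hl a)
    (N.one_le_truncDist hab)
  have hbC : b ∈ A \ B := Finset.mem_sdiff.2 ⟨hb, hbB⟩
  have hWB : w₀ ≤ ∑ v ∈ B, w v := hwa.trans (Finset.single_le_sum (fun v _ => hw v) haB)
  have hWC : w₀ ≤ ∑ v ∈ A \ B, w v := hwb.trans (Finset.single_le_sum (fun v _ => hw v) hbC)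
  have hsub : ∀ X ⊆ A, w₀ ≤ ∑ v ∈ X, w v → Real.log ((∑ v ∈ X, w v) / w₀) ≤ Λ :=
    fun X hX hWX => by
      refine le_trans (Real.log_le_log (div_pos (by linarith) hw₀) ?_) hlog
      exact div_le_div_of_nonneg_right
        (Finset.sum_le_sum_of_subset_of_nonneg hX fun v _ _ => hw v) hw₀.le
  obtain ⟨M₁, P₁, hloop₁, hMP₁, hsep₁⟩ := ih B
    ((Finset.ssubset_iff_of_subset hBA).2 ⟨b, hb, hbB⟩) hWB (hsub B hBA hWB)
  obtain ⟨M₂, P₂, hloop₂, hMP₂, hsep₂⟩ := ih (A \ B)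
    ((Finset.ssubset_iff_of_subset Finset.sdiff_subset).2
      ⟨a, ha, fun h => (Finset.mem_sdiff.1 h).2 haB⟩) hWC (hsub _ Finset.sdiff_subset hWC)
  have hmem : ∀ {e}, e ∈ (M ∪ (M₁ ∪ M₂)) ∪ (P ∪ (P₁ ∪ P₂)) ↔
      e ∈ M ∪ P ∨ e ∈ M₁ ∪ P₁ ∨ e ∈ M₂ ∪ P₂ := by
    intro e
    simp only [Finset.mem_union]
    tauto
  refine ⟨M ∪ (M₁ ∪ M₂), P ∪ (P₁ ∪ P₂), fun e he => ?_, ?_, fun i h1 h2 => ?_⟩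
  · rcases hmem.1 he with h | h | h
    · exact hloop e h
    · exact hloop₁ e h
    · exact hloop₂ e h
  · have h1 := N.splitCost_union_le M P (M₁ ∪ M₂) (P₁ ∪ P₂)
    have h2 := N.splitCost_union_le M₁ P₁ M₂ P₂
    have hsum : ∑ v ∈ A, w v = ∑ v ∈ B, w v + ∑ v ∈ A \ B, w v := by
      rw [add_comm, Finset.sum_sdiff hBA]
    have hx : ∀ x, 0 < x → Real.log ((∑ v ∈ A, w v) / w₀) =
        Real.log ((∑ v ∈ A, w v) / x) + Real.log (x / w₀) := fun x hx => by
      rw [← Real.log_mul (div_pos (by linarith) hx).ne' (div_pos hx hw₀).ne',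
        div_mul_div_cancel₀ hx.ne']
    have hkey : (∑ v ∈ A, w v) * Real.log ((∑ v ∈ A, w v) / w₀) =
        ((∑ v ∈ B, w v) * Real.log ((∑ v ∈ A, w v) / ∑ v ∈ B, w v) +
          (∑ v ∈ A \ B, w v) * Real.log ((∑ v ∈ A, w v) / ∑ v ∈ A \ B, w v)) +
        (∑ v ∈ B, w v) * Real.log ((∑ v ∈ B, w v) / w₀) +
        (∑ v ∈ A \ B, w v) * Real.log ((∑ v ∈ A \ B, w v) / w₀) := by
      have hB := hx (∑ v ∈ B, w v) (by linarith)
      have hC := hx (∑ v ∈ A \ B, w v) (by linarith)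
      have : (∑ v ∈ A, w v) * Real.log ((∑ v ∈ A, w v) / w₀) =
          (∑ v ∈ B, w v) * Real.log ((∑ v ∈ A, w v) / w₀) +
          (∑ v ∈ A \ B, w v) * Real.log ((∑ v ∈ A, w v) / w₀) := by
        rw [← add_mul, ← hsum]
      rw [this]
      nth_rewrite 1 [hB]
      rw [hC]
      ring
    rw [hkey, mul_add, mul_add]
    linarith
  · set ε : ℝ := 1 / (8 * J)
    set D : Set E := {e | lM e < ε ∧ lP e < ε ∧ e ∉ M ∪ (M₁ ∪ M₂) ∪ (P ∪ (P₁ ∪ P₂))}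
    have hD₁ : D ⊆ {e | lM e < ε ∧ lP e < ε ∧ e ∉ M₁ ∪ P₁} := fun e he =>
      ⟨he.1, he.2.1, fun h => he.2.2 (hmem.2 (.inr (.inl h)))⟩
    have hD₂ : D ⊆ {e | lM e < ε ∧ lP e < ε ∧ e ∉ M₂ ∪ P₂} := fun e he =>
      ⟨he.1, he.2.1, fun h => he.2.2 (hmem.2 (.inr (.inr h)))⟩
    have hB : ∀ e ∈ D, N.tail e ∈ B → N.head e ∉ A \ B := fun e he h3 h4 =>
      he.2.2 (hmem.2 (.inl (hcut e h3 h4 he.1 he.2.1)))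
    by_cases hsB : s i ∈ B
    · by_cases htB : t i ∈ B
      · refine (hsep₁ i hsB htB).imp (fun h h' => h ?_) (fun h h' => h ?_)
        · exact (N.reflTransGen_stepIn_of_source hD₁ hB h' hsB).1
        · exact (N.reflTransGen_stepIn_of_source hD₁ hB h' htB).1
      · exact .inl fun h' => htB (N.reflTransGen_stepIn_of_source hD₁ hB h' hsB).2
    · have hsC : s i ∈ A \ B := Finset.mem_sdiff.2 ⟨h1, hsB⟩
      by_cases htB : t i ∈ B
      · exact .inr fun h' => hsB (N.reflTransGen_stepIn_of_source hD₁ hB h' htB).2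
      · have htC : t i ∈ A \ B := Finset.mem_sdiff.2 ⟨h2, htB⟩
        refine (hsep₂ i hsC htC).imp (fun h h' => h ?_) (fun h h' => h ?_)
        · exact (N.reflTransGen_stepIn_of_target hD₂ hB h' htC).1
        · exact (N.reflTransGen_stepIn_of_target hD₂ hB h' hsC).1

lemma one_lt_two_mul_mul_log {m : ℕ} (hm : 2 ≤ m) :
    1 < 2 * Real.log (2 * m) * Real.log (Real.log (2 * m) / Real.log 2) := by
  have hlog2 := Real.log_two_gt_d9
  have hm' : (2 : ℝ) ≤ m := by exact_mod_cast hm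
  have h1 : 2 * Real.log 2 ≤ Real.log (2 * m) := by
    rw [Real.log_mul (by norm_num) (by positivity)]
    linarith [Real.log_le_log (by norm_num) hm']
  have h2 : Real.log 2 ≤ Real.log (Real.log (2 * m) / Real.log 2) := by
    refine Real.log_le_log (by norm_num) ?_
    rwa [le_div_iff₀ (by linarith)]
  nlinarith

/-- The multicut bound in terms of the number of terminals. -/
lemma exists_multicut_of_terminals (N : DirPolyNet V E) {k : ℕ} (s t : Fin k → V)
    (hst : ∀ i, s i ≠ t i) {m : ℕ} (hm : 2 ≤ m)
    (hcard : (Finset.univ.image s ∪ Finset.univ.image t).card ≤ m) {Z : ℝ} (hZ₀ : 0 < Z)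
    (hZ : N.maxThroughputSym s t ≤ Z) :
    ∃ F : Finset E, (∀ i, N.Separates F (s i) (t i) ∨ N.Separates F (t i) (s i)) ∧
      N.cutCost F ≤
        160 * (Real.log (2 * m) * Real.log (Real.log (2 * m) / Real.log 2)) * Z := by
  obtain ⟨lM, lP, hlM, hlP, hsum, hlen⟩ := N.exists_lengths s t hst
  set T := Finset.univ.image s ∪ Finset.univ.image t with hT
  set Λ := Real.log (2 * m) with hΛ
  set G := Real.log (Λ / Real.log 2) with hG
  have hm' : (2 : ℝ) ≤ m := by exact_mod_cast hm
  have hm₀ : (0 : ℝ) < m := by linarith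
  have hΛ₀ : 0 < Λ := Real.log_pos (by linarith)
  have hΛG : 1 < 2 * Λ * G := one_lt_two_mul_mul_log hm
  set J := ⌊2 * Λ * G⌋₊ + 1 with hJ
  have hJlt : 2 * Λ * G < J := by
    rw [hJ]
    exact_mod_cast Nat.lt_floor_add_one (2 * Λ * G)
  have hJle : (J : ℝ) ≤ 4 * Λ * G := by
    have := Nat.floor_le (show 0 ≤ 2 * Λ * G by linarith)
    rw [hJ]
    push_cast
    linarith
  have hJ₀ : (0 : ℝ) < J := by linarith
  set w₀ := Z / m with hw₀
  have hw₀pos : 0 < w₀ := div_pos hZ₀ hm₀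
  set w : V → ℝ := fun v => N.vertexCost lM lP v + if v ∈ T then w₀ else 0 with hw
  have hcost : ∀ v, N.vertexCost lM lP v ≤ w v := fun v => by
    simp only [hw]
    split_ifs <;> linarith
  have hwnn : ∀ v, 0 ≤ w v := fun v => (N.vertexCost_nonneg lM lP v).trans (hcost v)
  have hwT : ∀ v ∈ T, w₀ ≤ w v := fun v hv => by
    simp only [hw, if_pos hv]
    linarith [N.vertexCost_nonneg lM lP v]
  have hsT : ∀ i, s i ∈ T := fun i =>
    Finset.mem_union_left _ (Finset.mem_image_of_mem _ (Finset.mem_univ _))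
  have htT : ∀ i, t i ∈ T := fun i =>
    Finset.mem_union_right _ (Finset.mem_image_of_mem _ (Finset.mem_univ _))
  have hW : ∑ v, w v ≤ 2 * Z := by
    rw [hw, Finset.sum_add_distrib, Finset.sum_ite_mem, Finset.univ_inter, Finset.sum_const,
      nsmul_eq_mul]
    have : (T.card : ℝ) * w₀ ≤ m * w₀ :=
      mul_le_mul_of_nonneg_right (by exact_mod_cast hcard) hw₀pos.le
    rw [hw₀, mul_div_cancel₀ _ hm₀.ne'] at this
    linarith
  rcases Nat.eq_zero_or_pos k with rfl | hk
  · refine ⟨∅, fun i => i.elim0, ?_⟩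
    have h1 := N.cutCost_le_splitCost (M := ∅) (P := ∅) (by simp)
    rw [N.splitCost_empty, Finset.union_empty] at h1
    refine h1.trans ?_
    have : 0 < Λ * G := by linarith
    positivity
  have hW₀ : w₀ ≤ ∑ v, w v := (hwT _ (hsT ⟨0, hk⟩)).trans
    (Finset.single_le_sum (fun v _ => hwnn v) (Finset.mem_univ _))
  have hlog : Real.log ((∑ v, w v) / w₀) ≤ Λ := by
    refine Real.log_le_log (div_pos (by linarith) hw₀pos) ?_
    rw [div_le_iff₀ hw₀pos, hw₀, mul_assoc, mul_div_cancel₀ _ hm₀.ne']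
    exact hW
  obtain ⟨M, P, hloop, hMP, hsep⟩ := N.exists_recursive_cut hlM hlP hwnn hcost hw₀pos hΛ₀
    (Nat.succ_pos _) hJlt (fun i => hwT _ (hsT i)) (fun i => hwT _ (htT i)) hlen Finset.univ hW₀
    hlog
  set ε : ℝ := 1 / (8 * J) with hε
  have hε₀ : 0 < ε := by positivity
  have hlong := N.splitCost_long_le lM lP hε₀
  set M₀ := Finset.univ.filter fun e => ε ≤ lM e ∧ N.tail e ≠ N.head e with hM₀
  set P₀ := Finset.univ.filter fun e => ε ≤ lP e ∧ N.tail e ≠ N.head e with hP₀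
  refine ⟨(M₀ ∪ M) ∪ (P₀ ∪ P), fun i => ?_, ?_⟩
  · refine (hsep i (Finset.mem_univ _) (Finset.mem_univ _)).imp ?_ ?_ <;>
    · rintro h ⟨p, hp, hpF⟩
      refine h (N.reflTransGen_stepIn_of_isWalk hp fun e he => ?_)
      by_cases hl : N.tail e = N.head e
      · exact .inr hl
      · have hF := hpF e he
        simp only [Finset.mem_union, not_or, hM₀, hP₀, Finset.mem_filter, Finset.mem_univ,
          true_and, not_and, not_not] at hF
        refine .inl ⟨?_, ?_, ?_⟩
        · by_contra h1
          exact hl (hF.1.1 (not_lt.1 h1))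
        · by_contra h1
          exact hl (hF.2.1 (not_lt.1 h1))
        · exact fun h1 => (Finset.mem_union.1 h1).elim hF.1.2 hF.2.2
  · refine (N.cutCost_le_splitCost fun e he => ?_).trans
      ((N.splitCost_union_le M₀ P₀ M P).trans ?_)
    · simp only [Finset.mem_union, hM₀, hP₀, Finset.mem_filter] at he
      rcases he with (h | h) | (h | h)
      · exact h.2.2
      · exact hloop e (Finset.mem_union_left _ h)
      · exact h.2.2
      · exact hloop e (Finset.mem_union_right _ h)
    · have h1 : N.splitCost M₀ P₀ ≤ 32 * (Λ * G) * Z := by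
        refine hlong.trans ?_
        rw [hε, one_div, inv_inv]
        have hsum₀ : 0 ≤ ∑ v, N.vertexCost lM lP v :=
          Finset.sum_nonneg fun v _ => N.vertexCost_nonneg lM lP v
        calc 8 * (J : ℝ) * ∑ v, N.vertexCost lM lP v
            ≤ 8 * (4 * Λ * G) * Z := by
              refine mul_le_mul ?_ (hsum.trans hZ) hsum₀ ?_
              · linarith
              · linarith
          _ = 32 * (Λ * G) * Z := by ring
      have h2 : N.splitCost M P ≤ 128 * (Λ * G) * Z := by
        refine hMP.trans ?_
        have h3 : 16 * (J : ℝ) / Λ ≤ 64 * G := by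
          rw [div_le_iff₀ hΛ₀]
          linarith
        have h4 : (∑ v, w v) * Real.log ((∑ v, w v) / w₀) ≤ 2 * Z * Λ :=
          mul_le_mul hW hlog (Real.log_nonneg ((one_le_div hw₀pos).2 hW₀)) (by linarith)
        have h5 : 0 ≤ (∑ v, w v) * Real.log ((∑ v, w v) / w₀) :=
          mul_nonneg (by linarith) (Real.log_nonneg ((one_le_div hw₀pos).2 hW₀))
        calc 16 * (J : ℝ) / Λ * ((∑ v, w v) * Real.log ((∑ v, w v) / w₀))
            ≤ 64 * G * (2 * Z * Λ) := mul_le_mul h3 h4 h5 ((by positivity : _ ≤ _).trans h3)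
          _ = 128 * (Λ * G) * Z := by ring
      linarith

/-- The multicut bound in terms of the number of terminals and the maximum throughput. -/
lemma exists_multicut_le_throughput (N : DirPolyNet V E) {k : ℕ} (s t : Fin k → V)
    (hst : ∀ i, s i ≠ t i) {m : ℕ} (hm : 2 ≤ m)
    (hcard : (Finset.univ.image s ∪ Finset.univ.image t).card ≤ m) :
    ∃ F : Finset E, (∀ i, N.Separates F (s i) (t i) ∨ N.Separates F (t i) (s i)) ∧
      N.cutCost F ≤ 160 * (Real.log (2 * m) * Real.log (Real.log (2 * m) / Real.log 2)) *
        N.maxThroughputSym s t := by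
  have hβ := N.throughputSym_nonneg s t
  set 𝓕 : Finset (Finset E) := Finset.univ.filter fun F =>
    ∀ i, N.Separates F (s i) (t i) ∨ N.Separates F (t i) (s i) with h𝓕
  have hne : 𝓕.Nonempty := by
    obtain ⟨F, hF, -⟩ := N.exists_multicut_of_terminals s t hst hm hcard
      (Z := N.maxThroughputSym s t + 1) (by linarith) (by linarith)
    exact ⟨F, Finset.mem_filter.2 ⟨Finset.mem_univ _, hF⟩⟩
  obtain ⟨F, hF, hmin⟩ := 𝓕.exists_min_image N.cutCost hne
  refine ⟨F, (Finset.mem_filter.1 hF).2, ?_⟩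
  have hK : 0 < 160 * (Real.log (2 * m) * Real.log (Real.log (2 * m) / Real.log 2)) := by
    linarith [one_lt_two_mul_mul_log hm]
  refine le_of_forall_pos_le_add fun η hη => ?_
  obtain ⟨F', hF', hle⟩ := N.exists_multicut_of_terminals s t hst hm hcard
    (Z := N.maxThroughputSym s t +
      η / (160 * (Real.log (2 * m) * Real.log (Real.log (2 * m) / Real.log 2))))
    (by positivity) (by linarith [div_pos hη hK])
  refine ((hmin F' (Finset.mem_filter.2 ⟨Finset.mem_univ _, hF'⟩)).trans hle).trans_eq ?_
  rw [mul_add, mul_div_cancel₀ _ hK.ne']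

end DirPolyNet

lemma log_mul_log_log_le_sq {k m : ℕ} (hk : 2 ≤ k) (hm : 2 ≤ m) (hmk : m ≤ 2 * k) :
    Real.log (2 * m) * Real.log (Real.log (2 * m) / Real.log 2) ≤ 64 * Real.log k ^ 2 := by
  have hlog2 := Real.log_two_gt_d9
  have hm' : (2 : ℝ) ≤ m := by exact_mod_cast hm
  have hk' : (2 : ℝ) ≤ k := by exact_mod_cast hk
  have hmk' : (m : ℝ) ≤ 2 * k := by exact_mod_cast hmk
  have hL : Real.log 2 ≤ Real.log k := Real.log_le_log (by norm_num) hk'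
  have hΛ₀ : 0 < Real.log (2 * m) := Real.log_pos (by linarith)
  have h1 : Real.log (2 * m) ≤ 3 * Real.log k := by
    have h2 : Real.log (2 * m) ≤ Real.log (2 * (2 * k)) :=
      Real.log_le_log (by linarith) (by linarith)
    have h3 : Real.log (2 * (2 * k)) = Real.log 2 + (Real.log 2 + Real.log k) := by
      rw [Real.log_mul (by norm_num) (by positivity), Real.log_mul (by norm_num) (by positivity)]
    linarith
  have h3 : Real.log (Real.log (2 * m) / Real.log 2) ≤ 6 * Real.log k := by
    refine (Real.log_le_self (by positivity)).trans ?_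
    rw [div_le_iff₀ (by linarith)]
    nlinarith
  nlinarith

lemma log_mul_log_log_le {n m : ℕ} (hn : 3 ≤ n) (hm : 2 ≤ m) (hmn : m ≤ n) :
    Real.log (2 * m) * Real.log (Real.log (2 * m) / Real.log 2) ≤
      64 * (Real.log n * Real.log (Real.log n)) := by
  have hlog2 := Real.log_two_gt_d9
  have hlog2' := Real.log_two_lt_d9
  have hm' : (2 : ℝ) ≤ m := by exact_mod_cast hm
  have hn' : (3 : ℝ) ≤ n := by exact_mod_cast hn
  have hmn' : (m : ℝ) ≤ n := by exact_mod_cast hmn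
  have hΛ₀ : 0 < Real.log (2 * m) := Real.log_pos (by linarith)
  have hL : 1.05 ≤ Real.log n := by
    have h1 : Real.log 3 ≤ Real.log n := Real.log_le_log (by norm_num) hn'
    have h2 : (1.05 : ℝ) ≤ Real.log 3 := by
      have h3 : Real.log 3 = Real.log (3 / Real.exp 1) + 1 := by
        rw [Real.log_div (by norm_num) (Real.exp_pos 1).ne', Real.log_exp]
        ring
      have h4 := Real.one_sub_inv_le_log_of_pos (x := 3 / Real.exp 1) (by positivity)
      rw [inv_div] at h4
      linarith [Real.exp_one_lt_d9]
    linarith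
  have hLL : 1 / 22 ≤ Real.log (Real.log n) := by
    refine le_trans ?_ (Real.one_sub_inv_le_log_of_pos (by linarith))
    have : (Real.log n)⁻¹ ≤ (1.05)⁻¹ := inv_anti₀ (by norm_num) hL
    norm_num at this ⊢
    linarith
  have h1 : Real.log (2 * m) ≤ 2 * Real.log n := by
    rw [Real.log_mul (by norm_num) (by positivity)]
    linarith [Real.log_le_log (by linarith) hmn', Real.log_le_log (by norm_num) (hm'.trans hmn')]
  have h3 : Real.log (Real.log (2 * m) / Real.log 2) ≤ 32 * Real.log (Real.log n) := by
    have h4 : Real.log (2 * m) / Real.log 2 ≤ 2 * 2 * Real.log n := by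
      rw [div_le_iff₀ (by linarith)]
      nlinarith
    have h5 := Real.log_le_log (div_pos hΛ₀ (by linarith)) h4
    have h6 : Real.log (2 * 2 * Real.log n) =
        Real.log 2 + Real.log 2 + Real.log (Real.log n) := by
      rw [Real.log_mul (by norm_num) (by linarith), Real.log_mul (by norm_num) (by norm_num)]
    rw [h6] at h5
    have h7 : (31 : ℝ) / 22 ≤ 31 * Real.log (Real.log n) := by linarith
    have h8 : 2 * Real.log 2 ≤ 31 / 22 := by linarith
    linarith
  nlinarith

/-- There is a universal constant `C` such that in every directed
polymatroidal network on `n ≥ 3` nodes with symmetric demands on `k ≥ 2` unordered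
pairs, there is a feasible multicut `F` (separating `(s i, t i)` or `(t i, s i)` for
each `i`) with `ν(F) ≤ C · min{(log k)², (log n)·(log log n)} · β`, where `β` is the
maximum throughput flow for the symmetric demands. -/
theorem multicut_gap_symmetric_demands :
    ∃ C : ℝ, 0 < C ∧
      ∀ (V E : Type) [Fintype V] [Fintype E] [DecidableEq V] [DecidableEq E]
        (N : DirPolyNet V E) (k : ℕ) (s t : Fin k → V),
        3 ≤ Fintype.card V → 2 ≤ k →
        (∀ i, s i ≠ t i) →
        ∃ F : Finset E,
          (∀ i, N.Separates F (s i) (t i) ∨ N.Separates F (t i) (s i)) ∧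
          N.cutCost F ≤ C *
            min ((Real.log k) ^ 2)
              (Real.log (Fintype.card V) * Real.log (Real.log (Fintype.card V))) *
            N.maxThroughputSym s t := by
  refine ⟨160 * 64, by norm_num, fun V E _ _ _ _ N k s t hn hk hst => ?_⟩
  have hm : 2 ≤ (Finset.univ.image s ∪ Finset.univ.image t).card := by
    refine Finset.one_lt_card.2 ⟨s ⟨0, by omega⟩, ?_, t ⟨0, by omega⟩, ?_, hst _⟩ <;> simp
  have hmk : (Finset.univ.image s ∪ Finset.univ.image t).card ≤ 2 * k := by
    refine (Finset.card_union_le _ _).trans ?_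
    have h1 := Finset.card_image_le (s := Finset.univ) (f := s)
    have h2 := Finset.card_image_le (s := Finset.univ) (f := t)
    rw [Finset.card_univ, Fintype.card_fin] at h1 h2
    omega
  obtain ⟨F, hF, hle⟩ := N.exists_multicut_le_throughput s t hst hm le_rfl
  refine ⟨F, hF, hle.trans (mul_le_mul_of_nonneg_right ?_ (N.throughputSym_nonneg s t))⟩
  rw [mul_assoc]
  refine mul_le_mul_of_nonneg_left ?_ (by norm_num)
  rw [mul_min_of_nonneg _ _ (by norm_num : (0 : ℝ) ≤ 64)]
  exact le_min (log_mul_log_log_le_sq hk hm hmk) (log_mul_log_log_le hn hm (Finset.card_le_univ _))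
end

section
/- There is a universal constant C such that: in every undirected polymatroidal network, for any multicommodity flow instance with k ≥ 2 source-sink pairs, the minimum multicut cost min{ν(F) : F a multicut} is at most C·(log k) times the value of the maximum throughput multicommodity flow. -/
open Finset MeasureTheory
open scoped ENNReal Classical

/-- `UWalk ep1 ep2 s t p`: in the undirected graph whose edge `e` has endpoints
`ep1 e` and `ep2 e`, the list of edges `p` forms a walk from `s` to `t`. -/
def UWalk {V E : Type} [DecidableEq V] (ep1 ep2 : E → V) : V → V → List E → Prop
  | s, t, [] => s = t
  | s, t, e :: p => (ep1 e = s ∨ ep2 e = s) ∧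
      UWalk ep1 ep2 (if ep1 e = s then ep2 e else ep1 e) t p

/-- The list of vertices visited by an undirected walk starting at `s`. -/
def uwalkVerts {V E : Type} [DecidableEq V] (ep1 ep2 : E → V) : V → List E → List V
  | s, [] => [s]
  | s, e :: p => s :: uwalkVerts ep1 ep2 (if ep1 e = s then ep2 e else ep1 e) p

/-- A simple undirected path from `s` to `t`. -/
def UIsPath {V E : Type} [DecidableEq V] (ep1 ep2 : E → V) (s t : V) (p : List E) : Prop :=
  UWalk ep1 ep2 s t p ∧ (uwalkVerts ep1 ep2 s p).Nodup

/-- `F` separates `s` and `t`: they lie in different connected components of `G∖F`. -/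
def USep {V E : Type} [DecidableEq V] (ep1 ep2 : E → V) (F : Finset E) (s t : V) : Prop :=
  ¬ ∃ p : List E, UWalk ep1 ep2 s t p ∧ ∀ e ∈ p, e ∉ F

/-- `δ(S)`: the set of edges with exactly one endpoint in `S`. -/
def uvcut {V E : Type} [Fintype E] [DecidableEq V] (ep1 ep2 : E → V) (S : Finset V) :
    Finset E :=
  Finset.univ.filter (fun e => (ep1 e ∈ S ∧ ep2 e ∉ S) ∨ (ep1 e ∉ S ∧ ep2 e ∈ S))

/-- Shortest-path distance (in `ℝ≥0∞`, `⊤` when unreachable) under edge lengths `len`. -/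
noncomputable def udist {V E : Type} [DecidableEq V] (ep1 ep2 : E → V) (len : E → ℝ)
    (u v : V) : ℝ≥0∞ :=
  ⨅ p : { p : List E // UWalk ep1 ep2 u v p }, ENNReal.ofReal ((p.1.map len).sum)

/-- The Lovász extension of `ρ` on the ground set `ground`,
`ρ̂(x) = ∫_0^∞ ρ({e ∈ ground : x e ≥ θ}) dθ` (which agrees with `∫_0^1` when `x ≤ 1`). -/
noncomputable def lovaszExt {E : Type} [Fintype E] (ρ : Finset E → ℝ)
    (ground : Finset E) (x : E → ℝ) : ℝ :=
  ∫ θ in Set.Ioi (0:ℝ), ρ (ground.filter (fun e => θ ≤ x e))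

/-- An undirected polymatroidal network: a finite undirected graph together with,
for each node `v`, a polymatroid `rho v` on the set of edges incident to `v`. -/
structure UPolyNet (V E : Type) [Fintype V] [Fintype E] [DecidableEq V] [DecidableEq E] where
  ep1 : E → V
  ep2 : E → V
  rho : V → Finset E → ℝ
  rho_empty : ∀ v, rho v ∅ = 0
  rho_nonneg : ∀ v A, A ⊆ Finset.univ.filter (fun e => ep1 e = v ∨ ep2 e = v) → 0 ≤ rho v A
  rho_mono : ∀ v A B, A ⊆ B → B ⊆ Finset.univ.filter (fun e => ep1 e = v ∨ ep2 e = v) →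
    rho v A ≤ rho v B
  rho_submod : ∀ v A B, A ⊆ Finset.univ.filter (fun e => ep1 e = v ∨ ep2 e = v) →
    B ⊆ Finset.univ.filter (fun e => ep1 e = v ∨ ep2 e = v) →
    rho v (A ∪ B) + rho v (A ∩ B) ≤ rho v A + rho v B

namespace UPolyNet

variable {V E : Type} [Fintype V] [Fintype E] [DecidableEq V] [DecidableEq E]

/-- The set `δ(v)` of edges incident to `v` (the ground set of `rho v`). -/
def incE (N : UPolyNet V E) (v : V) : Finset E :=
  Finset.univ.filter (fun e => N.ep1 e = v ∨ N.ep2 e = v)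

/-- The cost `ν(F)` of the edge cut `F`: the minimum over valid assignments `g` of
the edges of `F` to their endpoints of `Σ_v ρ_v(g⁻¹(v))`. -/
noncomputable def cutCost (N : UPolyNet V E) (F : Finset E) : ℝ :=
  sInf { c : ℝ | ∃ g : E → V, (∀ e ∈ F, g e = N.ep1 e ∨ g e = N.ep2 e) ∧
    c = ∑ v : V, N.rho v ((N.incE v ∩ F).filter (fun e => g e = v)) }

/-- Total flow on an edge `e`. -/
noncomputable def edgeFlow (N : UPolyNet V E) {ι : Type} [Fintype ι]
    (f : ι → List E → ℝ) (e : E) : ℝ :=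
  ∑ i : ι, ∑ᶠ p ∈ {p : List E | e ∈ p}, f i p

/-- The rate of commodity `i`. -/
noncomputable def rate {ι : Type} (f : ι → List E → ℝ) (i : ι) : ℝ :=
  ∑ᶠ p : List E, f i p

/-- A feasible multicommodity flow for the source-sink pairs `(s i, t i)`. -/
structure IsFlow (N : UPolyNet V E) {ι : Type} [Fintype ι] (s t : ι → V)
    (f : ι → List E → ℝ) : Prop where
  nonneg : ∀ i p, 0 ≤ f i p
  supp : ∀ i p, f i p ≠ 0 → UIsPath N.ep1 N.ep2 (s i) (t i) p
  fin : ∀ i, (Function.support (f i)).Finite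
  cap : ∀ v, ∀ S ⊆ N.incE v, ∑ e ∈ S, N.edgeFlow f e ≤ N.rho v S

/-- `D(F)`: the total demand of the pairs separated by `F`. -/
noncomputable def sepDemand (N : UPolyNet V E) {ι : Type} [Fintype ι]
    (s t : ι → V) (D : ι → ℝ) (F : Finset E) : ℝ :=
  ∑ i : ι, if USep N.ep1 N.ep2 F (s i) (t i) then D i else 0

/-- The value of the maximum throughput multicommodity flow. -/
noncomputable def maxThroughput (N : UPolyNet V E) {ι : Type} [Fintype ι]
    (s t : ι → V) : ℝ :=
  sSup { r : ℝ | ∃ f : ι → List E → ℝ, N.IsFlow s t f ∧ r = ∑ i : ι, rate f i }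

/-- The value of the maximum concurrent multicommodity flow for demands `D`. -/
noncomputable def maxConcurrent (N : UPolyNet V E) {ι : Type} [Fintype ι]
    (s t : ι → V) (D : ι → ℝ) : ℝ :=
  sSup { lam : ℝ | ∃ f : ι → List E → ℝ, N.IsFlow s t f ∧ ∀ i, rate f i = lam * D i }

/-- The vector `d_v`: for an edge `e` incident to `v`, its portion `ℓ(e,v)`
assigned to `v` by the fractional cut solution with portions `c1` (at `ep1`)
and `c2` (at `ep2`). -/
def dvec (N : UPolyNet V E) (c1 c2 : E → ℝ) (v : V) : E → ℝ :=
  fun e => if N.ep1 e = v then c1 e else c2 e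

/-- `ρ̂_v(d_v)`, the contribution of the node `v` to the fractional cut cost. -/
noncomputable def nodeVol (N : UPolyNet V E) (c1 c2 : E → ℝ) (v : V) : ℝ :=
  lovaszExt (N.rho v) (N.incE v) (N.dvec c1 c2 v)

/-- `vol(X) = Σ_{v ∈ X} ρ̂_v(d_v)`. -/
noncomputable def vol (N : UPolyNet V E) (c1 c2 : E → ℝ) (X : Finset V) : ℝ :=
  ∑ v ∈ X, N.nodeVol c1 c2 v

end UPolyNet

open UPolyNet

/-- Weak form of linear programming duality for a packing problem: if every solution of the packing
problem has value at most `M`, then for each `M' > M` some fractional covering costs at most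
`M'`. -/
theorem exists_fractional_cover {R J : Type*} [Fintype R] [Fintype J] (A : R → J → ℝ)
    (b : R → ℝ) (hA : ∀ r j, 0 ≤ A r j) (hb : ∀ r, 0 ≤ b r) (row : J → R)
    (hrow : ∀ j, 1 ≤ A (row j) j) {M M' : ℝ} (hMM' : M < M')
    (hM : ∀ x : J → ℝ, (∀ j, 0 ≤ x j) → (∀ r, ∑ j, A r j * x j ≤ b r) → ∑ j, x j ≤ M) :
    ∃ y : R → ℝ, (∀ r, 0 ≤ y r) ∧ (∀ j, 1 ≤ ∑ r, y r * A r j) ∧ ∑ r, y r * b r ≤ M' := by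
  let φ : (J → ℝ) →ₗ[ℝ] (R → ℝ) × ℝ :=
    { toFun := fun x => (fun r => ∑ j, A r j * x j, ∑ j, x j)
      map_add' := fun x x' => by
        ext <;> simp [mul_add, Finset.sum_add_distrib]
      map_smul' := fun c x => by
        ext <;> simp [Finset.mul_sum, mul_left_comm] }
  have hφ : Continuous φ := φ.continuous_of_finiteDimensional
  let box : Set (J → ℝ) := Set.Icc 0 (fun j => b (row j))
  let tgt : Set ((R → ℝ) × ℝ) := Set.Iic b ×ˢ Set.Ici M'
  obtain ⟨f, u, v, hu, huv, hv⟩ := geometric_hahn_banach_compact_closed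
    (s := φ '' box) (t := tgt) ((convex_Icc _ _).linear_image φ) (isCompact_Icc.image hφ)
    ((convex_Iic b).prod (convex_Ici M')) (isClosed_Iic.prod isClosed_Ici) (by
      rw [Set.disjoint_left]
      rintro _ ⟨x, hx, rfl⟩ ⟨h1, h2⟩
      have h3 := hM x hx.1 h1
      have h4 : M' ≤ ∑ j, x j := h2
      linarith)
  have hf : ∀ z c, f (z, c) = ∑ r, z r * f (Pi.single r 1, 0) + c * f (0, 1) := by
    intro z c
    have hz : (z, c) = ∑ r, z r • ((Pi.single r 1, 0) : (R → ℝ) × ℝ)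
        + c • ((0, 1) : (R → ℝ) × ℝ) := by
      ext i
      · simp [Prod.fst_sum, Finset.sum_apply, Pi.single_apply]
      · simp [Prod.snd_sum]
    conv_lhs => rw [hz]
    simp only [map_add, map_sum, map_smul, smul_eq_mul]
  set a : R → ℝ := fun r => f (Pi.single r 1, 0)
  set lam : ℝ := f (0, 1)
  have hbase : v < ∑ r, b r * a r + M' * lam := by
    have := hv (b, M') ⟨le_refl b, le_refl M'⟩
    rwa [hf] at this
  have hu0 : 0 < u := by
    have := hu (φ 0) ⟨0, ⟨le_refl _, fun j => hb _⟩, rfl⟩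
    simpa using this
  have hanp : ∀ r, a r ≤ 0 := by
    intro r
    by_contra! h
    set κ := (∑ r, b r * a r + M' * lam - v) / a r
    have hκ : 0 < κ := div_pos (by linarith) h
    have := hv (b - κ • Pi.single r 1, M') ⟨by
      intro r'
      by_cases hr : r' = r
      · subst hr; simp [hκ.le]
      · simp [hr], le_refl M'⟩
    rw [hf] at this
    have h2 : ∑ r', (b - κ • Pi.single r 1 : R → ℝ) r' * a r' = ∑ r', b r' * a r' - κ * a r := by
      simp [sub_mul, Finset.sum_sub_distrib, Pi.single_apply]
    have h3 : κ * a r = ∑ r, b r * a r + M' * lam - v := div_mul_cancel₀ _ h.ne'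
    change v < ∑ r', (b - κ • Pi.single r 1 : R → ℝ) r' * a r' + M' * lam at this
    linarith
  have hsum : ∑ r, b r * a r ≤ 0 :=
    Finset.sum_nonpos fun r _ => mul_nonpos_of_nonneg_of_nonpos (hb r) (hanp r)
  have hM0 : 0 ≤ M := by simpa using hM 0 (by simp) (by simpa using hb)
  have hlam0 : 0 < lam := by
    by_contra! h
    nlinarith
  let y₀ : R → ℝ := fun r => -a r / lam
  have hy₀ : ∀ r, 0 ≤ y₀ r := fun r => div_nonneg (by linarith [hanp r]) hlam0.le
  let gap : J → ℝ := fun j => max 0 (1 - ∑ r, y₀ r * A r j)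
  have hgap : ∀ j, 0 ≤ gap j := fun j => le_max_left _ _
  have hcost : ∑ r, y₀ r * b r + ∑ j, gap j * b (row j) ≤ M' := by
    let x : J → ℝ := fun j => if 0 ≤ 1 - ∑ r, y₀ r * A r j then b (row j) else 0
    have hx : x ∈ box := by
      constructor <;> intro j <;> dsimp only [x] <;> split_ifs <;> simp [hb]
    have h1 := hu (φ x) ⟨x, hx, rfl⟩
    have h2 : f (φ x) = ∑ r, (∑ j, A r j * x j) * a r + (∑ j, x j) * lam := hf _ _
    have h3 : ∀ r, a r = - (y₀ r * lam) := fun r => by simp [y₀, hlam0.ne']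
    have h4 : ∑ r, (∑ j, A r j * x j) * a r + (∑ j, x j) * lam
        = lam * ∑ j, gap j * b (row j) := by
      have h5 : ∑ r, (∑ j, A r j * x j) * a r = - (lam * ∑ j, (∑ r, y₀ r * A r j) * x j) := by
        simp only [h3, Finset.sum_mul, Finset.mul_sum, ← Finset.sum_neg_distrib]
        rw [Finset.sum_comm]
        exact Finset.sum_congr rfl fun j _ => Finset.sum_congr rfl fun r _ => by ring
      have h6 : ∀ j, gap j * b (row j) = (1 - ∑ r, y₀ r * A r j) * x j := by
        intro j
        by_cases h : 0 ≤ 1 - ∑ r, y₀ r * A r j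
        · simp only [gap, x, if_pos h, max_eq_right h]
        · simp only [gap, x, if_neg h, max_eq_left (not_le.1 h).le, zero_mul, mul_zero]
      simp only [h5, h6, sub_mul, Finset.sum_sub_distrib, one_mul]
      ring
    have h7 : ∑ r, b r * a r = - (lam * ∑ r, y₀ r * b r) := by
      simp only [h3, Finset.mul_sum, ← Finset.sum_neg_distrib]
      exact Finset.sum_congr rfl fun r _ => by ring
    have h8 : lam * (∑ r, y₀ r * b r + ∑ j, gap j * b (row j)) ≤ lam * M' := by
      rw [h2, h4] at h1
      linarith
    exact le_of_mul_le_mul_left h8 hlam0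
  refine ⟨fun r => y₀ r + ∑ j, if row j = r then gap j else 0, fun r => add_nonneg (hy₀ r)
    (Finset.sum_nonneg fun j _ => by split_ifs <;> simp [hgap]), fun j => ?_, ?_⟩
  · have h1 : gap j ≤ ∑ r, (∑ j, if row j = r then gap j else 0) * A r j := by
      calc gap j ≤ gap j * A (row j) j := le_mul_of_one_le_right (hgap j) (hrow j)
        _ ≤ (∑ j', if row j' = row j then gap j' else 0) * A (row j) j := by
          refine mul_le_mul_of_nonneg_right ?_ (hA _ _)
          have := Finset.single_le_sum (f := fun j' => if row j' = row j then gap j' else 0)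
            (fun j' _ => by split_ifs <;> simp [hgap]) (Finset.mem_univ j)
          simpa using this
        _ ≤ _ := Finset.single_le_sum
          (f := fun r => (∑ j, if row j = r then gap j else 0) * A r j)
          (fun r _ => mul_nonneg (Finset.sum_nonneg fun j _ => by split_ifs <;> simp [hgap])
            (hA _ _)) (Finset.mem_univ (row j))
    have h2 : 1 - ∑ r, y₀ r * A r j ≤ gap j := le_max_right _ _
    simp only [add_mul, Finset.sum_add_distrib]
    linarith
  · have h1 : ∑ r, (∑ j, if row j = r then gap j else 0) * b r = ∑ j, gap j * b (row j) := by
      simp only [Finset.sum_mul]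
      rw [Finset.sum_comm]
      exact Finset.sum_congr rfl fun j _ => by simp [ite_mul]
    simp only [add_mul, Finset.sum_add_distrib, h1]
    exact hcost

/-- The greedy algorithm for polymatroids: there is a vector in the polymatroid of `ρ` that is tight
on all sets that are upward closed for the order given by `ℓ`. -/
theorem exists_greedy_vector {E : Type*} [DecidableEq E] (ρ : Finset E → ℝ) (ℓ : E → ℝ)
    (h0 : ρ ∅ = 0) (D : Finset E) (hmono : ∀ A B, A ⊆ B → B ⊆ D → ρ A ≤ ρ B)
    (hsub : ∀ A B, A ⊆ D → B ⊆ D → ρ (A ∪ B) + ρ (A ∩ B) ≤ ρ A + ρ B) :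
    ∃ w : E → ℝ, (∀ e, 0 ≤ w e) ∧ (∀ S ⊆ D, ∑ e ∈ S, w e ≤ ρ S) ∧
      ∀ L ⊆ D, (∀ e ∈ L, ∀ e' ∈ D, ℓ e ≤ ℓ e' → e' ∈ L) → ∑ e ∈ L, w e = ρ L := by
  induction D using Finset.induction_on_min_value ℓ with
  | empty =>
    refine ⟨0, by simp, fun S hS => ?_, fun L hL _ => ?_⟩
    · simp [Finset.subset_empty.1 hS, h0]
    · simp [Finset.subset_empty.1 hL, h0]
  | insert m D hm hmin ih =>
    have hD : D ⊆ insert m D := Finset.subset_insert _ _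
    obtain ⟨w, hw0, hwle, hweq⟩ := ih (fun A B h h' => hmono A B h (h'.trans hD))
      (fun A B h h' => hsub A B (h.trans hD) (h'.trans hD))
    have hne : ∀ S ⊆ D, ∑ e ∈ S, Function.update w m (ρ (insert m D) - ρ D) e = ∑ e ∈ S, w e :=
      fun S hS => Finset.sum_congr rfl fun e he =>
        Function.update_of_ne (ne_of_mem_of_not_mem (hS he) hm) _ _
    refine ⟨Function.update w m (ρ (insert m D) - ρ D), fun e => ?_, fun S hS => ?_,
      fun L hL hup => ?_⟩
    · by_cases he : e = m
      · subst he; simpa using hmono _ _ hD subset_rfl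
      · simpa [he] using hw0 e
    · by_cases hmS : m ∈ S
      · obtain ⟨T, hmT, rfl⟩ : ∃ T, m ∉ T ∧ insert m T = S :=
          ⟨S.erase m, Finset.notMem_erase _ _, Finset.insert_erase hmS⟩
        have hT : T ⊆ D := (Finset.insert_subset_insert_iff hmT).1 hS
        have h1 := hsub (insert m T) D hS hD
        have h2 : insert m T ∪ D = insert m D := by
          rw [Finset.insert_union, Finset.union_eq_right.2 hT]
        have h3 : insert m T ∩ D = T := by
          rw [Finset.insert_inter_of_notMem hm, Finset.inter_eq_left.2 hT]
        rw [h2, h3] at h1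
        rw [Finset.sum_insert hmT, hne T hT, Function.update_self]
        linarith [hwle T hT]
      · have hSD := (Finset.subset_insert_iff_of_notMem hmS).1 hS
        rw [hne S hSD]
        exact hwle S hSD
    · by_cases hmL : m ∈ L
      · have hLD : L = insert m D := by
          refine hL.antisymm fun e he => hup m hmL e he ?_
          rcases Finset.mem_insert.1 he with rfl | h
          · exact le_rfl
          · exact hmin e h
        rw [hLD, Finset.sum_insert hm, hne D subset_rfl, Function.update_self,
          hweq D subset_rfl fun _ _ e' he' _ => he']
        ring
      · have hLD := (Finset.subset_insert_iff_of_notMem hmL).1 hL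
        rw [hne L hLD]
        exact hweq L hLD fun e he e' he' h => hup e he e' (hD he') h

theorem sum_inv_card_le_harmonic {ι : Type*} (δ : ι → ℝ) (s : Finset ι) :
    ∑ j ∈ s, ((#{i ∈ s | δ i ≤ δ j} : ℝ))⁻¹ ≤ (harmonic #s : ℝ) := by
  induction s using Finset.induction_on_max_value δ with
  | empty => simp
  | insert m s hm hmax ih =>
    rw [Finset.sum_insert hm, Finset.card_insert_of_notMem hm, harmonic_succ, add_comm]
    push_cast
    refine add_le_add (le_trans (Finset.sum_le_sum fun j hj => ?_) ih) ?_
    · refine inv_anti₀ ?_ ?_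
      · exact_mod_cast Finset.card_pos.2 ⟨j, by simp [hj]⟩
      · exact_mod_cast Finset.card_le_card (Finset.filter_subset_filter _ (Finset.subset_insert m s))
    · rw [Finset.filter_true_of_mem, Finset.card_insert_of_notMem hm]
      · push_cast; rfl
      · intro i hi
        rcases Finset.mem_insert.1 hi with rfl | h
        · exact le_rfl
        · exact hmax i h

/-- A uniformly random permutation puts a given element of `T` before all others with probability
at most `1 / #T`. -/
theorem card_perm_first_mul_card_le {k : ℕ} (T : Finset (Fin k)) (j : Fin k) :
    #{σ : Equiv.Perm (Fin k) | ∀ i ∈ T, σ j ≤ σ i} * #T ≤ k.factorial := by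
  let P : Fin k → Finset (Equiv.Perm (Fin k)) := fun j => {σ | ∀ i ∈ T, σ j ≤ σ i}
  have hle : ∀ j' ∈ T, #(P j) ≤ #(P j') := by
    intro j' hj'
    refine Finset.card_le_card_of_injOn (fun σ => σ * Equiv.swap j j') ?_
      fun σ _ τ _ h => mul_right_cancel h
    intro σ hσ
    have hσ : ∀ i ∈ T, σ j ≤ σ i := by simpa [P] using hσ
    simp only [P, Finset.coe_filter, Finset.mem_univ, true_and, Set.mem_ofPred_eq,
      Equiv.Perm.mul_apply, Equiv.swap_apply_right]
    intro i hi
    by_cases h1 : i = j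
    · rw [h1, Equiv.swap_apply_left]; exact hσ _ hj'
    · by_cases h2 : i = j'
      · rw [h2, Equiv.swap_apply_right]
      · rw [Equiv.swap_apply_of_ne_of_ne h1 h2]; exact hσ _ hi
  have hdisj : (T : Set (Fin k)).PairwiseDisjoint P := by
    intro i hi i' hi' hne
    refine Finset.disjoint_left.2 fun σ h h' => hne ?_
    have h : ∀ l ∈ T, σ i ≤ σ l := by simpa [P] using h
    have h' : ∀ l ∈ T, σ i' ≤ σ l := by simpa [P] using h'
    exact σ.injective (le_antisymm (h _ hi') (h' _ hi))
  calc #(P j) * #T = ∑ _j' ∈ T, #(P j) := by simp [mul_comm]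
    _ ≤ ∑ j' ∈ T, #(P j') := Finset.sum_le_sum hle
    _ = #(T.biUnion P) := (Finset.card_biUnion hdisj).symm
    _ ≤ k.factorial := by
      simpa [Fintype.card_perm] using Finset.card_le_univ (T.biUnion P)

/-- Some point of `(0, 1/2)` is covered by a weighted family of intervals at most as much as on
average. -/
theorem exists_lightly_covered_point {ι : Type*} (s : Finset ι) (c a ℓ : ι → ℝ)
    (hc : ∀ i ∈ s, 0 ≤ c i) (hℓ : ∀ i ∈ s, 0 ≤ ℓ i) :
    ∃ r : ℝ, 0 < r ∧ r < 1 / 2 ∧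
      ∑ i ∈ s, (if r ∈ Set.Ico (a i - ℓ i) (a i + ℓ i) then c i else 0)
        ≤ 4 * ∑ i ∈ s, c i * ℓ i := by
  let G : ℝ → ℝ := fun r => ∑ i ∈ s, (Set.Ico (a i - ℓ i) (a i + ℓ i)).indicator (fun _ => c i) r
  have hint : ∀ i ∈ s, Integrable
      ((Set.Ico (a i - ℓ i) (a i + ℓ i)).indicator fun _ => c i) (volume : Measure ℝ) := fun i _ =>
    (integrable_indicator_iff measurableSet_Ico).2 (integrableOn_const (by simp))
  have hG : Integrable G := integrable_finsetSum _ hint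
  have hvol : (volume : Measure ℝ) (Set.Ioo 0 (1 / 2)) = ENNReal.ofReal (1 / 2) := by
    simp
  obtain ⟨r, hr, hle⟩ := exists_le_setAverage (μ := volume) (s := Set.Ioo (0 : ℝ) (1 / 2))
    (f := G) (by rw [hvol]; simp) (by rw [hvol]; simp) hG.integrableOn
  refine ⟨r, hr.1, hr.2, ?_⟩
  have h1 : ∫ r in Set.Ioo (0 : ℝ) (1 / 2), G r ≤ ∫ r, G r :=
    setIntegral_le_integral hG (Filter.Eventually.of_forall fun r =>
      Finset.sum_nonneg fun i hi => Set.indicator_nonneg (fun _ _ => hc i hi) _)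
  have h2 : ∫ r, G r = 2 * ∑ i ∈ s, c i * ℓ i := by
    rw [integral_finsetSum _ hint, Finset.mul_sum]
    refine Finset.sum_congr rfl fun i hi => ?_
    rw [integral_indicator measurableSet_Ico, setIntegral_const, Measure.real, Real.volume_Ico,
      ENNReal.toReal_ofReal (by linarith [hℓ i hi]), smul_eq_mul]
    ring
  rw [setAverage_eq, Measure.real, hvol, ENNReal.toReal_ofReal (by norm_num), smul_eq_mul] at hle
  calc _ = G r := by simp only [G, Set.indicator_apply]
    _ ≤ _ := hle
    _ ≤ _ := by norm_num; linarith

/-- Given the distances `δ` from a point to the centers, their priorities `σ` and a radius `r`,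
the center of highest priority whose ball meets the `ℓ`-neighbourhood of the point does not contain
that neighbourhood in its ball. -/
def CutAt {k : ℕ} (σ : Equiv.Perm (Fin k)) (r : ℝ) (δ : Fin k → ℝ) (ℓ : ℝ) : Prop :=
  ∃ j, δ j - ℓ ≤ r ∧ r < δ j + ℓ ∧ ∀ i, δ i - ℓ ≤ r → σ j ≤ σ i

theorem CutAt.of_first {k : ℕ} {σ : Equiv.Perm (Fin k)} {r : ℝ} {δ : Fin k → ℝ} {ℓ : ℝ}
    {j : Fin k} (hj : δ j - ℓ ≤ r) (hj' : r < δ j + ℓ)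
    (hfirst : ∀ i, δ i ≤ r → σ j ≤ σ i) : CutAt σ r δ ℓ := by
  obtain ⟨m, hm, hmin⟩ := Finset.exists_min_image ({i | δ i - ℓ ≤ r} : Finset (Fin k)) σ
    ⟨j, by simpa using hj⟩
  simp only [Finset.mem_filter, Finset.mem_univ, true_and] at hm hmin
  refine ⟨m, hm, ?_, hmin⟩
  by_cases h : δ m ≤ r
  · rwa [σ.injective (le_antisymm (hmin j hj) (hfirst m h))]
  · linarith

theorem CutAt.mono {k : ℕ} {σ : Equiv.Perm (Fin k)} {r : ℝ} {δ : Fin k → ℝ} {ℓ ℓ' : ℝ}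
    (hℓℓ' : ℓ ≤ ℓ') (h : CutAt σ r δ ℓ) : CutAt σ r δ ℓ' := by
  obtain ⟨j, h1, h2, h3⟩ := h
  exact CutAt.of_first (j := j) (by linarith) (by linarith)
    fun i hi => h3 i (by linarith)

/-- The center `j` captures a point whose distances to the centers are `δ`. -/
def Captures {k : ℕ} (σ : Equiv.Perm (Fin k)) (r : ℝ) (δ : Fin k → ℝ) (j : Fin k) : Prop :=
  δ j ≤ r ∧ ∀ i, δ i ≤ r → σ j ≤ σ i

theorem exists_captures {k : ℕ} (σ : Equiv.Perm (Fin k)) {r : ℝ} {δ : Fin k → ℝ} {i : Fin k}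
    (hi : δ i ≤ r) : ∃ j, Captures σ r δ j := by
  obtain ⟨m, hm, hmin⟩ := Finset.exists_min_image ({i | δ i ≤ r} : Finset (Fin k)) σ
    ⟨i, by simpa using hi⟩
  simp only [Finset.mem_filter, Finset.mem_univ, true_and] at hm hmin
  exact ⟨m, hm, hmin⟩

/-- If two adjacent points are in different clusters, then one of them is cut at its portion of
the edge. -/
theorem cutAt_or_cutAt {k : ℕ} {σ : Equiv.Perm (Fin k)} {r : ℝ} {δ δ' : Fin k → ℝ} {ℓ ℓ' : ℝ}
    (hℓ : 0 ≤ ℓ) (hℓ' : 0 ≤ ℓ') (h1 : ∀ i, δ i ≤ δ' i + (ℓ + ℓ'))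
    (h2 : ∀ i, δ' i ≤ δ i + (ℓ + ℓ')) (hne : ¬ ∀ j, Captures σ r δ j ↔ Captures σ r δ' j) :
    CutAt σ r δ ℓ ∨ CutAt σ r δ' ℓ' := by
  by_cases hex : ∃ i, δ i ≤ r ∨ δ' i ≤ r
  · obtain ⟨i, hi⟩ := hex
    obtain ⟨m, hm, hmin⟩ := Finset.exists_min_image
      ({i | δ i ≤ r ∨ δ' i ≤ r} : Finset (Fin k)) σ ⟨i, by simpa using hi⟩
    simp only [Finset.mem_filter, Finset.mem_univ, true_and] at hm hmin
    by_cases hm1 : δ m ≤ r <;> by_cases hm2 : δ' m ≤ r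
    · refine absurd (fun j => ⟨fun hj => ?_, fun hj => ?_⟩) hne
      · obtain rfl : j = m := σ.injective (le_antisymm (hj.2 m hm1) (hmin j (.inl hj.1)))
        exact ⟨hm2, fun i hi => hmin i (.inr hi)⟩
      · obtain rfl : j = m := σ.injective (le_antisymm (hj.2 m hm2) (hmin j (.inr hj.1)))
        exact ⟨hm1, fun i hi => hmin i (.inl hi)⟩
    · by_cases h : r < δ m + ℓ
      · exact .inl (.of_first (j := m) (by linarith) h fun i hi => hmin i (.inl hi))
      · exact .inr (.of_first (j := m) (by linarith [h2 m]) (by linarith)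
          fun i hi => hmin i (.inr hi))
    · by_cases h : r < δ' m + ℓ'
      · exact .inr (.of_first (j := m) (by linarith) h fun i hi => hmin i (.inr hi))
      · exact .inl (.of_first (j := m) (by linarith [h1 m]) (by linarith)
          fun i hi => hmin i (.inl hi))
    · exact absurd hm (by tauto)
  · push Not at hex
    exact absurd (fun j => ⟨fun hj => absurd hj.1 (not_le.2 (hex j).1),
      fun hj => absurd hj.1 (not_le.2 (hex j).2)⟩) hne

/-- Averaging over radii in `(0, 1/2)` and priorities, a point is cut with probability at most
`4 ℓ` times the harmonic number of the number of centers. -/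
theorem exists_radius_perm_sum_cutAt_le {k : ℕ} {ι : Type*} (s : Finset ι) (w ℓ : ι → ℝ)
    (δ : ι → Fin k → ℝ) (hw : ∀ a ∈ s, 0 ≤ w a) (hℓ : ∀ a ∈ s, 0 ≤ ℓ a) :
    ∃ r : ℝ, 0 < r ∧ r < 1 / 2 ∧ ∃ σ : Equiv.Perm (Fin k),
      ∑ a ∈ s, (if CutAt σ r (δ a) (ℓ a) then w a else 0)
        ≤ 4 * harmonic k * ∑ a ∈ s, w a * ℓ a := by
  let near : ι → Fin k → Finset (Fin k) := fun a j => {i | δ a i ≤ δ a j}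
  have hself : ∀ a j, j ∈ near a j := fun a j => by simp [near]
  have hcard : ∀ a j, (0 : ℝ) < #(near a j) := fun a j => by
    exact_mod_cast Finset.card_pos.2 ⟨j, hself a j⟩
  obtain ⟨r, hr0, hr1, hr⟩ := exists_lightly_covered_point (s ×ˢ (Finset.univ : Finset (Fin k)))
    (fun q => w q.1 * (#(near q.1 q.2) : ℝ)⁻¹) (fun q => δ q.1 q.2) (fun q => ℓ q.1)
    (fun q hq => mul_nonneg (hw _ (Finset.mem_product.1 hq).1) (inv_nonneg.2 (hcard _ _).le))
    (fun q hq => hℓ _ (Finset.mem_product.1 hq).1)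
  refine ⟨r, hr0, hr1, ?_⟩
  let hit : ι → Fin k → Prop := fun a j => r ∈ Set.Ico (δ a j - ℓ a) (δ a j + ℓ a)
  let first : ι → Fin k → Equiv.Perm (Fin k) → Prop := fun a j σ => ∀ i ∈ near a j, σ j ≤ σ i
  have hcut : ∀ σ, ∀ a ∈ s, (if CutAt σ r (δ a) (ℓ a) then w a else 0)
      ≤ ∑ j, if hit a j then (if first a j σ then w a else 0) else 0 := by
    intro σ a ha
    have hnn : ∀ j ∈ Finset.univ,
        0 ≤ if hit a j then (if first a j σ then w a else 0) else 0 := fun j _ => by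
      have := hw a ha
      split_ifs <;> simp [this]
    split_ifs with h
    · obtain ⟨j, h1, h2, h3⟩ := h
      have hhit : hit a j := ⟨h1, h2⟩
      have hfirst : first a j σ := fun i hi => h3 i (by
        have : δ a i ≤ δ a j := by simpa [near] using hi
        linarith)
      have := Finset.single_le_sum hnn (Finset.mem_univ j)
      rwa [if_pos hhit, if_pos hfirst] at this
    · exact Finset.sum_nonneg hnn
  have hfirst : ∀ a j, (#{σ | first a j σ} : ℝ) ≤ k.factorial * (#(near a j) : ℝ)⁻¹ := by
    intro a j
    rw [← div_eq_mul_inv, le_div_iff₀ (hcard a j)]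
    exact_mod_cast card_perm_first_mul_card_le (near a j) j
  have hharm : ∀ a, ∑ j, (#(near a j) : ℝ)⁻¹ ≤ harmonic k := fun a => by
    simpa using sum_inv_card_le_harmonic (δ a) Finset.univ
  have hsum : ∑ q ∈ s ×ˢ (Finset.univ : Finset (Fin k)), w q.1 * (#(near q.1 q.2) : ℝ)⁻¹ * ℓ q.1
      ≤ harmonic k * ∑ a ∈ s, w a * ℓ a := by
    rw [Finset.sum_product, Finset.mul_sum]
    refine Finset.sum_le_sum fun a ha => ?_
    calc _ = (∑ j, (#(near a j) : ℝ)⁻¹) * (w a * ℓ a) := by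
          rw [Finset.sum_mul]
          exact Finset.sum_congr rfl fun j _ => by ring
      _ ≤ _ := mul_le_mul_of_nonneg_right (hharm a) (mul_nonneg (hw a ha) (hℓ a ha))
  obtain ⟨σ, -, hσ⟩ := Finset.exists_le_of_sum_le (s := (Finset.univ : Finset (Equiv.Perm (Fin k))))
    (f := fun σ => ∑ a ∈ s, (if CutAt σ r (δ a) (ℓ a) then w a else 0))
    (g := fun _ => 4 * harmonic k * ∑ a ∈ s, w a * ℓ a) Finset.univ_nonempty (by
      calc ∑ σ : Equiv.Perm (Fin k), ∑ a ∈ s, (if CutAt σ r (δ a) (ℓ a) then w a else 0)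
          ≤ ∑ σ : Equiv.Perm (Fin k), ∑ a ∈ s, ∑ j,
              (if hit a j then (if first a j σ then w a else 0) else 0) :=
            Finset.sum_le_sum fun σ _ => Finset.sum_le_sum (hcut σ)
        _ = ∑ a ∈ s, ∑ j, (if hit a j then #{σ | first a j σ} * w a else 0) := by
            rw [Finset.sum_comm]
            refine Finset.sum_congr rfl fun a _ => ?_
            rw [Finset.sum_comm]
            refine Finset.sum_congr rfl fun j _ => ?_
            by_cases h : hit a j
            · simp only [if_pos h]
              rw [← Finset.sum_filter, Finset.sum_const, nsmul_eq_mul]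
            · simp only [if_neg h, Finset.sum_const_zero]
        _ ≤ ∑ a ∈ s, ∑ j,
              k.factorial * (if hit a j then w a * (#(near a j) : ℝ)⁻¹ else 0) := by
            refine Finset.sum_le_sum fun a ha => Finset.sum_le_sum fun j _ => ?_
            split_ifs
            · nlinarith [mul_le_mul_of_nonneg_right (hfirst a j) (hw a ha)]
            · simp
        _ = k.factorial * ∑ q ∈ s ×ˢ (Finset.univ : Finset (Fin k)),
              (if hit q.1 q.2 then w q.1 * (#(near q.1 q.2) : ℝ)⁻¹ else 0) := by
            rw [Finset.sum_product, Finset.mul_sum]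
            exact Finset.sum_congr rfl fun a _ => (Finset.mul_sum _ _ _).symm
        _ ≤ k.factorial * (4 * (harmonic k * ∑ a ∈ s, w a * ℓ a)) :=
            mul_le_mul_of_nonneg_left (hr.trans (by linarith)) (by positivity)
        _ = _ := by
            rw [Finset.sum_const, Finset.card_univ, Fintype.card_perm, Fintype.card_fin,
              nsmul_eq_mul]
            ring)
  exact ⟨σ, hσ⟩

section Walk

variable {V E : Type} [DecidableEq V] {ep1 ep2 : E → V}

theorem UWalk.append {s u t : V} {p q : List E} (hp : UWalk ep1 ep2 s u p)
    (hq : UWalk ep1 ep2 u t q) : UWalk ep1 ep2 s t (p ++ q) := by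
  induction p generalizing s with
  | nil => obtain rfl : s = u := hp; exact hq
  | cons e p ih => exact ⟨hp.1, ih hp.2⟩

theorem uwalk_singleton (e : E) : UWalk ep1 ep2 (ep1 e) (ep2 e) [e] :=
  ⟨.inl rfl, if_pos rfl⟩

theorem uwalk_singleton' (e : E) : UWalk ep1 ep2 (ep2 e) (ep1 e) [e] := by
  refine ⟨.inr rfl, ?_⟩
  change (if ep1 e = ep2 e then ep2 e else ep1 e) = ep1 e
  split_ifs with h
  · exact h.symm
  · rfl

theorem UWalk.reverse {s t : V} {p : List E} (hp : UWalk ep1 ep2 s t p) :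
    UWalk ep1 ep2 t s p.reverse := by
  induction p generalizing s with
  | nil => obtain rfl : s = t := hp; rfl
  | cons e p ih =>
    rw [List.reverse_cons]
    refine (ih hp.2).append ?_
    by_cases h : ep1 e = s
    · subst h
      simpa using uwalk_singleton' (ep1 := ep1) (ep2 := ep2) e
    · obtain rfl : ep2 e = s := hp.1.resolve_left h
      simpa [h] using uwalk_singleton (ep1 := ep1) (ep2 := ep2) e

theorem uwalkVerts_length (s : V) (p : List E) :
    (uwalkVerts ep1 ep2 s p).length = p.length + 1 := by
  induction p generalizing s with
  | nil => rfl
  | cons e p ih => simp [uwalkVerts, ih]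

theorem exists_suffix_of_mem_uwalkVerts {u v t : V} {q : List E}
    (hq : UIsPath ep1 ep2 u t q) (hv : v ∈ uwalkVerts ep1 ep2 u q) :
    ∃ q', UIsPath ep1 ep2 v t q' ∧ q'.Sublist q := by
  induction q generalizing u with
  | nil =>
    obtain rfl : v = u := by simpa [uwalkVerts] using hv
    exact ⟨[], hq, List.Sublist.refl _⟩
  | cons e q ih =>
    rcases List.mem_cons.1 hv with rfl | hv
    · exact ⟨e :: q, hq, List.Sublist.refl _⟩
    · obtain ⟨q', h1, h2⟩ := ih ⟨hq.1.2, (List.nodup_cons.1 hq.2).2⟩ hv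
      exact ⟨q', h1, h2.cons e⟩

theorem UWalk.exists_uisPath {s t : V} {p : List E} (hp : UWalk ep1 ep2 s t p) :
    ∃ q, UIsPath ep1 ep2 s t q ∧ q.Sublist p := by
  induction p generalizing s with
  | nil => exact ⟨[], ⟨hp, by simp [uwalkVerts]⟩, List.Sublist.refl _⟩
  | cons e p ih =>
    obtain ⟨q, hq, hqp⟩ := ih hp.2
    by_cases hs : s ∈ uwalkVerts ep1 ep2 (if ep1 e = s then ep2 e else ep1 e) q
    · obtain ⟨q', h1, h2⟩ := exists_suffix_of_mem_uwalkVerts hq hs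
      exact ⟨q', h1, (h2.trans hqp).cons e⟩
    · exact ⟨e :: q, ⟨⟨hp.1, hq.1⟩, List.nodup_cons.2 ⟨hs, hq.2⟩⟩, hqp.cons_cons e⟩

theorem finite_setOf_uisPath [Fintype V] [Fintype E] (s t : V) :
    {p : List E | UIsPath ep1 ep2 s t p}.Finite := by
  refine (List.finite_length_le E (Fintype.card V)).subset fun p hp => ?_
  have := hp.2.length_le_card
  rw [uwalkVerts_length] at this
  exact (Nat.le_succ _).trans this

/-- A predicate that agrees at the ends of every edge outside `F` is constant along walks that
avoid `F`. -/
theorem UWalk.invariant {F : Finset E} {P : V → Prop}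
    (hP : ∀ e ∉ F, P (ep1 e) ↔ P (ep2 e)) {s t : V} {p : List E} (hp : UWalk ep1 ep2 s t p)
    (hpF : ∀ e ∈ p, e ∉ F) (hs : P s) : P t := by
  induction p generalizing s with
  | nil => obtain rfl : s = t := hp; exact hs
  | cons e p ih =>
    refine ih hp.2 (fun e' he' => hpF e' (List.mem_cons_of_mem _ he')) ?_
    have he := hP e (hpF e List.mem_cons_self)
    split_ifs with h
    · exact he.1 (h ▸ hs)
    · exact he.2 (hp.1.resolve_left h ▸ hs)

/-- The shortest-path distance truncated at `1`. -/
noncomputable def truncDist (ep1 ep2 : E → V) (len : E → ℝ) (s v : V) : ℝ :=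
  sInf {x | x = 1 ∨ ∃ p, UWalk ep1 ep2 s v p ∧ x = (p.map len).sum}

variable {len : E → ℝ}

theorem sum_map_nonneg (hlen : ∀ e, 0 ≤ len e) (p : List E) : 0 ≤ (p.map len).sum :=
  List.sum_nonneg fun x hx => by
    obtain ⟨e, -, rfl⟩ := List.mem_map.1 hx
    exact hlen e

theorem truncDist_le_of_mem (hlen : ∀ e, 0 ≤ len e) {s v : V} {x : ℝ}
    (hx : x = 1 ∨ ∃ p, UWalk ep1 ep2 s v p ∧ x = (p.map len).sum) :
    truncDist ep1 ep2 len s v ≤ x := by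
  refine csInf_le ⟨0, ?_⟩ hx
  rintro y (rfl | ⟨p, -, rfl⟩)
  · exact zero_le_one
  · exact sum_map_nonneg hlen p

theorem truncDist_self_le (hlen : ∀ e, 0 ≤ len e) (s : V) : truncDist ep1 ep2 len s s ≤ 0 :=
  truncDist_le_of_mem hlen (.inr ⟨[], rfl, rfl⟩)

theorem truncDist_le_add (hlen : ∀ e, 0 ≤ len e) {s u v : V} {e : E}
    (he : UWalk ep1 ep2 u v [e]) :
    truncDist ep1 ep2 len s v ≤ truncDist ep1 ep2 len s u + len e := by
  rw [← sub_le_iff_le_add]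
  refine le_csInf ⟨1, .inl rfl⟩ ?_
  rintro x (rfl | ⟨p, hp, rfl⟩)
  · linarith [truncDist_le_of_mem hlen (ep1 := ep1) (ep2 := ep2) (s := s) (v := v) (.inl rfl),
      hlen e]
  · have := truncDist_le_of_mem hlen (.inr ⟨p ++ [e], hp.append he, rfl⟩)
    simp only [List.map_append, List.sum_append, List.map_cons, List.map_nil, List.sum_cons,
      List.sum_nil, add_zero] at this
    linarith

theorem exists_uwalk_of_truncDist_lt {s v : V} {x : ℝ} (hx : x ≤ 1)
    (h : truncDist ep1 ep2 len s v < x) : ∃ p, UWalk ep1 ep2 s v p ∧ (p.map len).sum < x := by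
  obtain ⟨y, hy, hyx⟩ := exists_lt_of_csInf_lt ⟨1, .inl rfl⟩ h
  rcases hy with rfl | ⟨p, hp, rfl⟩
  · exact absurd hyx (not_lt.2 hx)
  · exact ⟨p, hp, hyx⟩

/-- If all paths from `a` to `b` have length at least `1`, then `a` and `b` do not both lie in a
ball of radius `1 / 2`. -/
theorem not_truncDist_lt_half (hlen : ∀ e, 0 ≤ len e) {a b s : V}
    (hab : ∀ p, UIsPath ep1 ep2 a b p → 1 ≤ (p.map len).sum)
    (ha : truncDist ep1 ep2 len s a < 1 / 2) : ¬ truncDist ep1 ep2 len s b < 1 / 2 := by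
  intro hb
  obtain ⟨p, hp, hp'⟩ := exists_uwalk_of_truncDist_lt (by norm_num) ha
  obtain ⟨q, hq, hq'⟩ := exists_uwalk_of_truncDist_lt (by norm_num) hb
  obtain ⟨m, hm, hsub⟩ := (hp.reverse.append hq).exists_uisPath
  have h1 : (m.map len).sum ≤ ((p.reverse ++ q).map len).sum :=
    (hsub.map len).sum_le_sum fun x hx => by
      obtain ⟨e, -, rfl⟩ := List.mem_map.1 hx
      exact hlen e
  simp only [List.map_append, List.sum_append, List.map_reverse, List.sum_reverse] at h1
  linarith [hab m hm]

end Walk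

namespace UPolyNet

variable {V E : Type} [Fintype V] [Fintype E] [DecidableEq V] [DecidableEq E]

theorem rho_nonneg_of_subset (N : UPolyNet V E) {v : V} {A : Finset E} (hA : A ⊆ N.incE v) :
    0 ≤ N.rho v A :=
  N.rho_nonneg v A hA

theorem mem_incE {N : UPolyNet V E} {v : V} {e : E} :
    e ∈ N.incE v ↔ N.ep1 e = v ∨ N.ep2 e = v := by
  simp [incE]

theorem cutCost_le (N : UPolyNet V E) {F : Finset E} (g : E → V)
    (hg : ∀ e ∈ F, g e = N.ep1 e ∨ g e = N.ep2 e) :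
    N.cutCost F ≤ ∑ v, N.rho v ((N.incE v ∩ F).filter (fun e => g e = v)) := by
  refine csInf_le ⟨0, ?_⟩ ⟨g, hg, rfl⟩
  rintro c ⟨g', -, rfl⟩
  exact Finset.sum_nonneg fun v _ => N.rho_nonneg_of_subset
    ((Finset.filter_subset _ _).trans Finset.inter_subset_left)

/-- Rounding of a fractional cut with portions `ℓ e v`, whose cost is measured by vectors `w v` in
the polymatroids that are tight on the level sets of the portions. -/
theorem exists_multicut_of_portions (N : UPolyNet V E) {k : ℕ} (s t : Fin k → V)
    (ℓ w : E → V → ℝ) (hℓ : ∀ e v, 0 ≤ ℓ e v) (hw : ∀ e v, 0 ≤ w e v)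
    (htight : ∀ v, ∀ L ⊆ N.incE v, (∀ e ∈ L, ∀ e' ∈ N.incE v, ℓ e v ≤ ℓ e' v → e' ∈ L) →
      ∑ e ∈ L, w e v = N.rho v L)
    (hpath : ∀ i p, UIsPath N.ep1 N.ep2 (s i) (t i) p →
      1 ≤ (p.map fun e => ℓ e (N.ep1 e) + ℓ e (N.ep2 e)).sum) :
    ∃ F : Finset E, (∀ i, USep N.ep1 N.ep2 F (s i) (t i)) ∧
      N.cutCost F ≤ 4 * harmonic k * ∑ v, ∑ e ∈ N.incE v, w e v * ℓ e v := by
  set len : E → ℝ := fun e => ℓ e (N.ep1 e) + ℓ e (N.ep2 e)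
  have hlen : ∀ e, 0 ≤ len e := fun e => add_nonneg (hℓ _ _) (hℓ _ _)
  let δ : V → Fin k → ℝ := fun v j => truncDist N.ep1 N.ep2 len (s j) v
  obtain ⟨r, hr0, hr1, σ, hσ⟩ := exists_radius_perm_sum_cutAt_le
    ((Finset.univ : Finset V).sigma fun v => N.incE v) (fun a => w a.2 a.1) (fun a => ℓ a.2 a.1)
    (fun a => δ a.1) (fun _ _ => hw _ _) (fun _ _ => hℓ _ _)
  rw [Finset.sum_sigma, Finset.sum_sigma] at hσ
  let F : Finset E := {e | ¬ ∀ j, Captures σ r (δ (N.ep1 e)) j ↔ Captures σ r (δ (N.ep2 e)) j}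
  have hF : ∀ e ∈ F, CutAt σ r (δ (N.ep1 e)) (ℓ e (N.ep1 e)) ∨
      CutAt σ r (δ (N.ep2 e)) (ℓ e (N.ep2 e)) := fun e he =>
    cutAt_or_cutAt (hℓ _ _) (hℓ _ _) (fun i => truncDist_le_add hlen (uwalk_singleton' e))
      (fun i => truncDist_le_add hlen (uwalk_singleton e)) (Finset.mem_filter.1 he).2
  refine ⟨F, fun i => ?_, ?_⟩
  · rintro ⟨p, hp, hpF⟩
    obtain ⟨j, hj⟩ := exists_captures σ (r := r) (δ := δ (s i)) (i := i)
      ((truncDist_self_le hlen _).trans hr0.le)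
    have hjt : Captures σ r (δ (t i)) j := by
      refine hp.invariant (P := fun v => Captures σ r (δ v) j) (fun e he => ?_) hpF hj
      have : ∀ j, Captures σ r (δ (N.ep1 e)) j ↔ Captures σ r (δ (N.ep2 e)) j := by
        simpa [F] using he
      exact this j
    exact not_truncDist_lt_half hlen (hpath i) (hj.1.trans_lt hr1) (hjt.1.trans_lt hr1)
  · let g : E → V := fun e =>
      if CutAt σ r (δ (N.ep1 e)) (ℓ e (N.ep1 e)) then N.ep1 e else N.ep2 e
    refine (N.cutCost_le g fun e _ => ?_).trans (le_trans (Finset.sum_le_sum fun v _ => ?_) hσ)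
    · dsimp only [g]; split_ifs <;> simp
    · rw [← Finset.sum_filter, htight v _ (Finset.filter_subset _ _)]
      · refine N.rho_mono v _ _ (fun e he => ?_) (Finset.filter_subset _ _)
        obtain ⟨he, rfl⟩ := Finset.mem_filter.1 he
        obtain ⟨he1, he2⟩ := Finset.mem_inter.1 he
        refine Finset.mem_filter.2 ⟨he1, ?_⟩
        dsimp only [g]
        split_ifs with h
        · exact h
        · exact (hF e he2).resolve_left h
      · intro e he e' he' hle
        exact Finset.mem_filter.2 ⟨he', (Finset.mem_filter.1 he).2.mono hle⟩

/-- The multicut obtained from a feasible solution `y` of the dual of the throughput problem. -/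
theorem exists_multicut_of_dual (N : UPolyNet V E) {k : ℕ} (s t : Fin k → V)
    (y : V → Finset E → ℝ) (hy : ∀ v S, 0 ≤ y v S)
    (hpath : ∀ i p, UIsPath N.ep1 N.ep2 (s i) (t i) p →
      1 ≤ ∑ v, ∑ S, y v S * #{e ∈ S ∩ N.incE v | e ∈ p}) :
    ∃ F : Finset E, (∀ i, USep N.ep1 N.ep2 F (s i) (t i)) ∧
      N.cutCost F ≤ 4 * harmonic k * ∑ v, ∑ S, y v S * N.rho v (S ∩ N.incE v) := by
  let ℓ : E → V → ℝ := fun e v => ∑ S, if e ∈ S ∩ N.incE v then y v S else 0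
  have hℓ : ∀ e v, 0 ≤ ℓ e v := fun e v =>
    Finset.sum_nonneg fun S _ => by split_ifs <;> simp [hy]
  have hℓ0 : ∀ e v, e ∉ N.incE v → ℓ e v = 0 := fun e v he =>
    Finset.sum_eq_zero fun S _ => if_neg fun h => he (Finset.mem_inter.1 h).2
  have hgreedy := fun v => exists_greedy_vector (N.rho v) (fun e => ℓ e v) (N.rho_empty v)
    (N.incE v) (N.rho_mono v) (N.rho_submod v)
  choose w hw hwle hwtight using hgreedy
  obtain ⟨F, hsep, hF⟩ := N.exists_multicut_of_portions s t ℓ (fun e v => w v e) hℓ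
    (fun e v => hw v e) hwtight (fun i p hp => by
      refine (hpath i p hp).trans ?_
      calc ∑ v, ∑ S, y v S * #{e ∈ S ∩ N.incE v | e ∈ p}
          = ∑ v, ∑ e ∈ p.toFinset, ℓ e v := by
            refine Finset.sum_congr rfl fun v _ => ?_
            rw [Finset.sum_comm]
            refine Finset.sum_congr rfl fun S _ => ?_
            have : {e ∈ S ∩ N.incE v | e ∈ p} = {e ∈ p.toFinset | e ∈ S ∩ N.incE v} := by
              ext e; simp [and_comm]
            rw [← Finset.sum_filter, Finset.sum_const, nsmul_eq_mul, mul_comm, this]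
        _ = ∑ e ∈ p.toFinset, ∑ v, ℓ e v := Finset.sum_comm
        _ ≤ ∑ e ∈ p.toFinset, (ℓ e (N.ep1 e) + ℓ e (N.ep2 e)) := by
            refine Finset.sum_le_sum fun e _ => ?_
            have h1 : ∑ v, ℓ e v = ∑ v ∈ {N.ep1 e, N.ep2 e}, ℓ e v := by
              refine (Finset.sum_subset (Finset.subset_univ _) fun v _ hv => hℓ0 e v ?_).symm
              rw [mem_incE]
              simp only [Finset.mem_insert, Finset.mem_singleton, not_or] at hv
              exact fun h => h.elim (fun h => hv.1 h.symm) fun h => hv.2 h.symm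
            rw [h1]
            by_cases h : N.ep1 e = N.ep2 e
            · simp [h, hℓ]
            · rw [Finset.sum_pair h]
        _ = ((p.dedup.map fun e => ℓ e (N.ep1 e) + ℓ e (N.ep2 e))).sum := by
            rw [← List.sum_toFinset _ p.nodup_dedup]
            exact Finset.sum_congr (by ext; simp) fun _ _ => rfl
        _ ≤ (p.map fun e => ℓ e (N.ep1 e) + ℓ e (N.ep2 e)).sum :=
            (p.dedup_sublist.map _).sum_le_sum fun x hx => by
              obtain ⟨e, -, rfl⟩ := List.mem_map.1 hx
              exact add_nonneg (hℓ _ _) (hℓ _ _))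
  refine ⟨F, hsep, hF.trans (mul_le_mul_of_nonneg_left (Finset.sum_le_sum fun v _ => ?_) ?_)⟩
  · calc ∑ e ∈ N.incE v, w v e * ℓ e v
        = ∑ S, y v S * ∑ e ∈ S ∩ N.incE v, w v e := by
          simp only [ℓ, Finset.mul_sum]
          rw [Finset.sum_comm]
          refine Finset.sum_congr rfl fun S _ => ?_
          rw [Finset.inter_comm, ← Finset.filter_mem_eq_inter, Finset.sum_filter]
          refine Finset.sum_congr rfl fun e he => ?_
          simp [he, mul_comm]
      _ ≤ _ := Finset.sum_le_sum fun S _ =>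
          mul_le_mul_of_nonneg_left (hwle v _ Finset.inter_subset_right) (hy v S)
  · have : (0 : ℚ) ≤ harmonic k := Finset.sum_nonneg fun i _ => by positivity
    exact mul_nonneg (by norm_num) (by exact_mod_cast this)

end UPolyNet

theorem finsum_eq_sum_subtype {α : Type*} {P : α → Prop} [Fintype {a // P a}] (g : α → ℝ)
    (hg : ∀ a, g a ≠ 0 → P a) : ∑ᶠ a, g a = ∑ a : {a // P a}, g a := by
  rw [← finsum_eq_sum_of_fintype, finsum_subtype_eq_finsum_cond]
  refine finsum_congr fun a => ?_
  rw [finsum_eq_if]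
  split_ifs with h
  · rfl
  · exact not_not.1 fun h' => h (hg a h')

namespace UPolyNet

variable {V E : Type} [Fintype V] [Fintype E] [DecidableEq V] [DecidableEq E]

theorem exists_mem_incE_of_uisPath (N : UPolyNet V E) {a b : V} (hab : a ≠ b) {p : List E}
    (hp : UIsPath N.ep1 N.ep2 a b p) : ∃ e ∈ N.incE a, e ∈ p := by
  cases p with
  | nil => exact absurd hp.1 hab
  | cons e p => exact ⟨e, mem_incE.2 hp.1.1, List.mem_cons_self⟩

section Flow

variable (N : UPolyNet V E) {k : ℕ} {s t : Fin k → V}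
  [∀ i, Fintype {p : List E // UIsPath N.ep1 N.ep2 (s i) (t i) p}]

theorem rate_eq_sum {f : Fin k → List E → ℝ}
    (hf : ∀ i p, f i p ≠ 0 → UIsPath N.ep1 N.ep2 (s i) (t i) p) (i : Fin k) :
    rate f i = ∑ p : {p : List E // UIsPath N.ep1 N.ep2 (s i) (t i) p}, f i p :=
  finsum_eq_sum_subtype _ (hf i)

theorem edgeFlow_eq_sum {f : Fin k → List E → ℝ}
    (hf : ∀ i p, f i p ≠ 0 → UIsPath N.ep1 N.ep2 (s i) (t i) p) (e : E) :
    N.edgeFlow f e = ∑ i, ∑ p : {p : List E // UIsPath N.ep1 N.ep2 (s i) (t i) p},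
      if e ∈ p.1 then f i p else 0 := by
  refine Finset.sum_congr rfl fun i _ => ?_
  simp only [Set.mem_ofPred_eq, finsum_eq_if]
  exact finsum_eq_sum_subtype (P := fun p => UIsPath N.ep1 N.ep2 (s i) (t i) p) _
    fun p hp => hf i p fun h => hp (by simp [h])

end Flow

theorem bddAbove_throughput (N : UPolyNet V E) {k : ℕ} {s t : Fin k → V} (hst : ∀ i, s i ≠ t i) :
    BddAbove {r : ℝ | ∃ f : Fin k → List E → ℝ, N.IsFlow s t f ∧ r = ∑ i, rate f i} := by
  have : ∀ i, Fintype {p : List E // UIsPath N.ep1 N.ep2 (s i) (t i) p} :=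
    fun i => (finite_setOf_uisPath (s i) (t i)).fintype
  refine ⟨∑ i, N.rho (s i) (N.incE (s i)), ?_⟩
  rintro r ⟨f, hf, rfl⟩
  refine Finset.sum_le_sum fun i _ => le_trans ?_ (hf.cap (s i) _ subset_rfl)
  rw [N.rate_eq_sum hf.supp]
  have hnn : ∀ e i' (p : {p : List E // UIsPath N.ep1 N.ep2 (s i') (t i') p}),
      0 ≤ if e ∈ p.1 then f i' p else 0 := fun e i' p => by
    split_ifs <;> simp [hf.nonneg]
  calc ∑ p : {p : List E // UIsPath N.ep1 N.ep2 (s i) (t i) p}, f i p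
      ≤ ∑ p : {p : List E // UIsPath N.ep1 N.ep2 (s i) (t i) p}, ∑ e ∈ N.incE (s i),
          if e ∈ p.1 then f i p else 0 := by
        refine Finset.sum_le_sum fun p _ => ?_
        obtain ⟨e, he, hep⟩ := N.exists_mem_incE_of_uisPath (hst i) p.2
        have := Finset.single_le_sum (fun e _ => hnn e i p) he
        rwa [if_pos hep] at this
    _ = ∑ e ∈ N.incE (s i), ∑ p : {p : List E // UIsPath N.ep1 N.ep2 (s i) (t i) p},
          if e ∈ p.1 then f i p else 0 := Finset.sum_comm
    _ ≤ ∑ e ∈ N.incE (s i), N.edgeFlow f e := by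
        refine Finset.sum_le_sum fun e _ => ?_
        rw [N.edgeFlow_eq_sum hf.supp]
        exact Finset.single_le_sum
          (f := fun i => ∑ p : {p : List E // UIsPath N.ep1 N.ep2 (s i) (t i) p},
            if e ∈ p.1 then f i p else 0)
          (fun i' _ => Finset.sum_nonneg fun p _ => hnn e i' p) (Finset.mem_univ i)

/-- Duality for the throughput problem. -/
theorem exists_dual_of_maxThroughput_lt (N : UPolyNet V E) {k : ℕ} {s t : Fin k → V}
    (hst : ∀ i, s i ≠ t i) {M : ℝ} (hM : N.maxThroughput s t < M) :
    ∃ y : V → Finset E → ℝ, (∀ v S, 0 ≤ y v S) ∧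
      (∀ i p, UIsPath N.ep1 N.ep2 (s i) (t i) p →
        1 ≤ ∑ v, ∑ S, y v S * #{e ∈ S ∩ N.incE v | e ∈ p}) ∧
      ∑ v, ∑ S, y v S * N.rho v (S ∩ N.incE v) ≤ M := by
  have : ∀ i, Fintype {p : List E // UIsPath N.ep1 N.ep2 (s i) (t i) p} :=
    fun i => (finite_setOf_uisPath (s i) (t i)).fintype
  let J := (i : Fin k) × {p : List E // UIsPath N.ep1 N.ep2 (s i) (t i) p}
  obtain ⟨y, hy, hcover, hcost⟩ := exists_fractional_cover (R := V × Finset E) (J := J)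
    (fun r j => #{e ∈ r.2 ∩ N.incE r.1 | e ∈ j.2.1}) (fun r => N.rho r.1 (r.2 ∩ N.incE r.1))
    (fun _ _ => Nat.cast_nonneg _) (fun r => N.rho_nonneg_of_subset Finset.inter_subset_right)
    (fun j => (s j.1, Finset.univ))
    (fun j => by
      obtain ⟨e, he, hep⟩ := N.exists_mem_incE_of_uisPath (hst j.1) j.2.2
      exact_mod_cast Finset.card_pos.2 ⟨e, by simp [he, hep]⟩) hM
    (fun x hx hcap => by
      let f : Fin k → List E → ℝ := fun i p =>
        if h : UIsPath N.ep1 N.ep2 (s i) (t i) p then x ⟨i, p, h⟩ else 0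
      have hfx : ∀ i (p : {p : List E // UIsPath N.ep1 N.ep2 (s i) (t i) p}),
          f i p = x ⟨i, p⟩ := fun i p => dif_pos p.2
      have hsupp : ∀ i p, f i p ≠ 0 → UIsPath N.ep1 N.ep2 (s i) (t i) p := fun i p h => by
        by_contra h'
        exact h (dif_neg h')
      refine le_csSup (N.bddAbove_throughput hst) ⟨f, ⟨fun i p => ?_, hsupp,
        fun i => (finite_setOf_uisPath (s i) (t i)).subset (hsupp i), fun v S hS => ?_⟩, ?_⟩
      · dsimp only [f]
        split_ifs
        · exact hx _
        · exact le_rfl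
      · refine le_of_eq_of_le ?_ ((hcap (v, S)).trans_eq
          (congrArg (N.rho v) (Finset.inter_eq_left.2 hS)))
        simp only [N.edgeFlow_eq_sum hsupp, hfx, Finset.inter_eq_left.2 hS]
        rw [Finset.sum_comm, Fintype.sum_sigma]
        refine Finset.sum_congr rfl fun i _ => ?_
        rw [Finset.sum_comm]
        refine Finset.sum_congr rfl fun p _ => ?_
        rw [← Finset.sum_filter, Finset.sum_const, nsmul_eq_mul]
      · rw [Fintype.sum_sigma]
        exact Finset.sum_congr rfl fun i _ => by simp only [N.rate_eq_sum hsupp, hfx])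
  simp only [Fintype.sum_prod_type] at hcover hcost
  exact ⟨fun v S => y (v, S), fun v S => hy _, fun i p hp => hcover ⟨i, p, hp⟩, hcost⟩

end UPolyNet

theorem four_mul_harmonic_le {k : ℕ} (hk : 2 ≤ k) : 4 * (harmonic k : ℝ) ≤ 10 * Real.log k := by
  have h1 := harmonic_le_one_add_log k
  have h2 : Real.log 2 ≤ Real.log k := Real.log_le_log (by norm_num) (by exact_mod_cast hk)
  linarith [Real.log_two_gt_d9]

/-- There is a universal constant `C` such that in every undirected
polymatroidal network, for any multicommodity flow instance with `k ≥ 2` source-sink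
pairs, there is a multicut `F` with `ν(F)` at most `C·(log k)` times the value of the
maximum throughput multicommodity flow. -/
theorem multicut_gap_undirected :
    ∃ C : ℝ, 0 < C ∧
      ∀ (V E : Type) [Fintype V] [Fintype E] [DecidableEq V] [DecidableEq E]
        (N : UPolyNet V E) (k : ℕ) (s t : Fin k → V),
        2 ≤ k →
        (∀ i, s i ≠ t i) →
        ∃ F : Finset E, (∀ i, USep N.ep1 N.ep2 F (s i) (t i)) ∧
          N.cutCost F ≤ C * Real.log k * N.maxThroughput s t := by
  refine ⟨10, by norm_num, fun V E _ _ _ _ N k s t hk hst => ?_⟩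
  have hlog : 0 < Real.log k := Real.log_pos (by exact_mod_cast hk)
  have happrox : ∀ M, N.maxThroughput s t < M →
      ∃ F : Finset E, (∀ i, USep N.ep1 N.ep2 F (s i) (t i)) ∧
        N.cutCost F ≤ 10 * Real.log k * M := by
    intro M hM
    obtain ⟨y, hy, hpath, hcost⟩ := N.exists_dual_of_maxThroughput_lt hst hM
    obtain ⟨F, hsep, hF⟩ := N.exists_multicut_of_dual s t y hy hpath
    refine ⟨F, hsep, hF.trans (mul_le_mul (four_mul_harmonic_le hk) hcost ?_ (by positivity))⟩
    exact Finset.sum_nonneg fun v _ => Finset.sum_nonneg fun S _ =>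
      mul_nonneg (hy v S) (N.rho_nonneg_of_subset Finset.inter_subset_right)
  obtain ⟨F₀, hF₀, -⟩ := happrox _ (lt_add_one _)
  obtain ⟨F, hF, hmin⟩ := Finset.exists_min_image
    ({F | ∀ i, USep N.ep1 N.ep2 F (s i) (t i)} : Finset (Finset E)) N.cutCost ⟨F₀, by simpa⟩
  refine ⟨F, (Finset.mem_filter.1 hF).2, le_of_forall_gt_imp_ge_of_dense fun c hc => ?_⟩
  have hpos : 0 < 10 * Real.log k := by positivity
  obtain ⟨F', hF', hle⟩ := happrox (c / (10 * Real.log k)) ((lt_div_iff₀' hpos).2 hc)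
  rw [mul_div_cancel₀ _ hpos.ne'] at hle
  exact (hmin F' (by simpa using hF')).trans hle
end
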